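/- arXiv:2603.03889 — 2 statements merged into one kernel-verified Lean document; each statement's English description precedes it below -/
import Mathlib

section
/- If 0 ≤ α < β/(1+β) < β < 1, then the Hausdorff dimension of E(α,β) is at least s(β²(1−α)/((1−β)(β−α(1+β)))). -/
open Filter MeasureTheory Set

/-- The Lüroth transformation on (0,1]. -/
noncomputable def lurothT (x : ℝ) : ℝ :=
  (⌊1/x⌋ : ℝ) * ((⌊1/x⌋ : ℝ) + 1) * (x - 1/((⌊1/x⌋ : ℝ) + 1))

/-- The n-th Lüroth digit (n ≥ 1): d₁(x) = ⌊1/x⌋ + 1, dₙ(x) = d₁(T^[n-1] x). -/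
noncomputable def lurothD (n : ℕ) (x : ℝ) : ℕ :=
  (⌊1 / (lurothT^[n-1] x)⌋ + 1).toNat

/-- The n-th maximal run-length function. -/
noncomputable def runLen (n : ℕ) (x : ℝ) : ℕ :=
  sSup {k : ℕ | 1 ≤ k ∧ ∃ j : ℕ, j + k ≤ n ∧
    ∀ i : ℕ, 1 ≤ i → i ≤ k → lurothD (j + i) x = lurothD (j + 1) x}

/-- The level set E(α,β). -/
noncomputable def Eab (a b : ℝ) : Set ℝ :=
  {x | x ∈ Set.Ioc (0:ℝ) 1 ∧
    Filter.liminf (fun n : ℕ => (runLen n x : ℝ) / n) Filter.atTop = a ∧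
    Filter.limsup (fun n : ℕ => (runLen n x : ℝ) / n) Filter.atTop = b}

/-- The series ∑_{t=2}^∞ (1/(2^u t(t-1)))^s. -/
noncomputable def lurothF (u s : ℝ) : ℝ :=
  ∑' t : ℕ, (1 / (2 ^ u * ((t : ℝ) + 2) * ((t : ℝ) + 1))) ^ s

/-- The contraction ratio of the branch of the Lüroth map with digit `k`. -/
noncomputable def lurothRatio (k : ℕ) : ℝ := 1 / ((k : ℝ) * ((k : ℝ) - 1))

/-- The real number with prescribed Lüroth digits. -/
noncomputable def lurothPoint (d : ℕ → ℕ) : ℝ :=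
  ∑' n : ℕ, (∏ i ∈ Finset.range n, lurothRatio (d i)) * (1 / (d n : ℝ))

lemma lurothRatio_pos {k : ℕ} (hk : 2 ≤ k) : 0 < lurothRatio k := by
  have : (2 : ℝ) ≤ k := by exact_mod_cast hk
  unfold lurothRatio
  have : 0 < (k : ℝ) - 1 := by linarith
  positivity

lemma lurothRatio_le_half {k : ℕ} (hk : 2 ≤ k) : lurothRatio k ≤ 1 / 2 := by
  have : (2 : ℝ) ≤ k := by exact_mod_cast hk
  unfold lurothRatio
  apply one_div_le_one_div_of_le <;> nlinarith

lemma one_div_add_lurothRatio {k : ℕ} (hk : 2 ≤ k) :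
    1 / (k : ℝ) + lurothRatio k = 1 / ((k : ℝ) - 1) := by
  have : (2 : ℝ) ≤ k := by exact_mod_cast hk
  have h1 : (k : ℝ) - 1 ≠ 0 := by linarith
  have h2 : (k : ℝ) ≠ 0 := by linarith
  unfold lurothRatio
  field_simp
  ring

lemma lurothTerm_nonneg {d : ℕ → ℕ} (hd : ∀ i, 2 ≤ d i) (n : ℕ) :
    0 ≤ (∏ i ∈ Finset.range n, lurothRatio (d i)) * (1 / (d n : ℝ)) :=
  mul_nonneg (Finset.prod_nonneg fun i _ => (lurothRatio_pos (hd i)).le) (by positivity)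

lemma sum_range_lurothTerm_le_one (n : ℕ) : ∀ {d : ℕ → ℕ}, (∀ i, 2 ≤ d i) →
    ∑ j ∈ Finset.range n, (∏ i ∈ Finset.range j, lurothRatio (d i)) * (1 / (d j : ℝ)) ≤ 1 := by
  induction n with
  | zero => intro d _; simp
  | succ n ih =>
    intro d hd
    have h := ih (d := fun i => d (i + 1)) (fun i => hd _)
    rw [Finset.sum_range_succ']
    simp only [Finset.prod_range_succ', Finset.range_zero, Finset.prod_empty, one_mul]
    have e : ∑ k ∈ Finset.range n, (∏ i ∈ Finset.range k, lurothRatio (d (i + 1))) *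
        lurothRatio (d 0) * (1 / (d (k + 1) : ℝ)) = lurothRatio (d 0) *
        ∑ k ∈ Finset.range n, (∏ i ∈ Finset.range k, lurothRatio (d (i + 1))) *
          (1 / (d (k + 1) : ℝ)) := by
      rw [Finset.mul_sum]
      exact Finset.sum_congr rfl fun _ _ => by ring
    rw [e]
    have h0 := lurothRatio_pos (hd 0)
    have h1 := one_div_add_lurothRatio (hd 0)
    have h2 : (2 : ℝ) ≤ d 0 := by exact_mod_cast hd 0
    have h3 : 1 / ((d 0 : ℝ) - 1) ≤ 1 := by
      rw [div_le_one] <;> linarith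
    nlinarith

lemma summable_lurothTerm {d : ℕ → ℕ} (hd : ∀ i, 2 ≤ d i) :
    Summable fun n : ℕ => (∏ i ∈ Finset.range n, lurothRatio (d i)) * (1 / (d n : ℝ)) :=
  summable_of_sum_range_le (lurothTerm_nonneg hd) fun n => sum_range_lurothTerm_le_one n hd

lemma lurothPoint_le_one {d : ℕ → ℕ} (hd : ∀ i, 2 ≤ d i) : lurothPoint d ≤ 1 :=
  Real.tsum_le_of_sum_range_le (lurothTerm_nonneg hd) fun n => sum_range_lurothTerm_le_one n hd

lemma lurothPoint_eq {d : ℕ → ℕ} (hd : ∀ i, 2 ≤ d i) :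
    lurothPoint d = 1 / (d 0 : ℝ) + lurothRatio (d 0) * lurothPoint (fun i => d (i + 1)) := by
  unfold lurothPoint
  rw [(summable_lurothTerm hd).tsum_eq_zero_add, ← tsum_mul_left]
  simp only [Finset.prod_range_succ', Finset.range_zero, Finset.prod_empty, one_mul]
  congr 1
  exact tsum_congr fun _ => by ring

lemma lurothPoint_nonneg {d : ℕ → ℕ} (hd : ∀ i, 2 ≤ d i) : 0 ≤ lurothPoint d :=
  tsum_nonneg (lurothTerm_nonneg hd)

lemma one_div_le_lurothPoint {d : ℕ → ℕ} (hd : ∀ i, 2 ≤ d i) :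
    1 / (d 0 : ℝ) ≤ lurothPoint d := by
  rw [lurothPoint_eq hd]
  have := mul_nonneg (lurothRatio_pos (hd 0)).le
    (lurothPoint_nonneg (d := fun i => d (i + 1)) fun i => hd _)
  linarith

lemma lurothPoint_pos {d : ℕ → ℕ} (hd : ∀ i, 2 ≤ d i) : 0 < lurothPoint d := by
  have h : (2 : ℝ) ≤ d 0 := by exact_mod_cast hd 0
  exact lt_of_lt_of_le (by positivity) (one_div_le_lurothPoint hd)

lemma lurothPoint_le {d : ℕ → ℕ} (hd : ∀ i, 2 ≤ d i) :
    lurothPoint d ≤ 1 / ((d 0 : ℝ) - 1) := by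
  rw [lurothPoint_eq hd, ← one_div_add_lurothRatio (hd 0)]
  have := mul_le_mul_of_nonneg_left
    (lurothPoint_le_one (d := fun i => d (i + 1)) fun i => hd _) (lurothRatio_pos (hd 0)).le
  linarith

lemma floor_one_div_lurothPoint {d : ℕ → ℕ} (hd : ∀ i, 2 ≤ d i) :
    ⌊1 / lurothPoint d⌋ = (d 0 : ℤ) - 1 := by
  have h2 : (2 : ℝ) ≤ d 0 := by exact_mod_cast hd 0
  have hp := lurothPoint_pos hd
  rw [Int.floor_eq_iff]
  push_cast
  constructor
  · rw [le_div_iff₀ hp]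
    have := lurothPoint_le hd
    rwa [le_div_iff₀ (by linarith), mul_comm] at this
  · rw [sub_add_cancel, div_lt_iff₀ hp]
    have h3 : 1 / (d 0 : ℝ) < lurothPoint d := by
      rw [lurothPoint_eq hd]
      have := mul_pos (lurothRatio_pos (hd 0))
        (lurothPoint_pos (d := fun i => d (i + 1)) fun i => hd _)
      linarith
    rwa [div_lt_iff₀ (by linarith), mul_comm] at h3

lemma lurothT_lurothPoint {d : ℕ → ℕ} (hd : ∀ i, 2 ≤ d i) :
    lurothT (lurothPoint d) = lurothPoint (fun i => d (i + 1)) := by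
  have h2 : (2 : ℝ) ≤ d 0 := by exact_mod_cast hd 0
  have h3 : (d 0 : ℝ) - 1 ≠ 0 := by linarith
  have h4 : (d 0 : ℝ) ≠ 0 := by linarith
  unfold lurothT
  rw [floor_one_div_lurothPoint hd, lurothPoint_eq hd]
  push_cast
  rw [sub_add_cancel]
  unfold lurothRatio
  field_simp
  ring

lemma lurothT_iterate_lurothPoint (n : ℕ) : ∀ {d : ℕ → ℕ}, (∀ i, 2 ≤ d i) →
    lurothT^[n] (lurothPoint d) = lurothPoint (fun i => d (i + n)) := by
  induction n with
  | zero => intro d _; rfl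
  | succ n ih =>
    intro d hd
    rw [Function.iterate_succ_apply, lurothT_lurothPoint hd, ih (fun i => hd _)]
    simp only [add_assoc]

lemma lurothD_lurothPoint {d : ℕ → ℕ} (hd : ∀ i, 2 ≤ d i) (n : ℕ) :
    lurothD (n + 1) (lurothPoint d) = d n := by
  unfold lurothD
  rw [Nat.add_sub_cancel, lurothT_iterate_lurothPoint n hd,
    floor_one_div_lurothPoint (fun i => hd _)]
  simp

/-- Points with digits bounded by `M` whose first digits differ are uniformly separated. -/
lemma lurothPoint_separated_zero {d e : ℕ → ℕ} (hd : ∀ i, 2 ≤ d i) (he : ∀ i, 2 ≤ e i) {M : ℕ}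
    (hdM : ∀ i, d i ≤ M) (h : d 0 < e 0) :
    1 / (M : ℝ) ^ 3 ≤ lurothPoint d - lurothPoint e := by
  have h2 : (2 : ℝ) ≤ d 0 := by exact_mod_cast hd 0
  have h2' : (2 : ℝ) ≤ d 1 := by exact_mod_cast hd 1
  have hM : (d 0 : ℝ) ≤ M := by exact_mod_cast hdM 0
  have hM1 : (d 1 : ℝ) ≤ M := by exact_mod_cast hdM 1
  have h3 : (d 0 : ℝ) + 1 ≤ e 0 := by exact_mod_cast h
  have he1 : lurothPoint e ≤ 1 / (d 0 : ℝ) :=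
    (lurothPoint_le he).trans (one_div_le_one_div_of_le (by linarith) (by linarith))
  have hd1 := one_div_le_lurothPoint (d := fun i => d (i + 1)) fun i => hd _
  have hd2 : 1 / (M : ℝ) ≤ lurothPoint (fun i => d (i + 1)) :=
    (one_div_le_one_div_of_le (by linarith) hM1).trans hd1
  have hr : 1 / (M : ℝ) ^ 2 ≤ lurothRatio (d 0) := by
    unfold lurothRatio
    apply one_div_le_one_div_of_le <;> nlinarith
  rw [lurothPoint_eq hd]
  have hm : 1 / (M : ℝ) ^ 3 ≤ lurothRatio (d 0) * lurothPoint (fun i => d (i + 1)) := by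
    calc 1 / (M : ℝ) ^ 3 = 1 / (M : ℝ) ^ 2 * (1 / (M : ℝ)) := by
          rw [one_div_mul_one_div]; ring_nf
      _ ≤ _ := mul_le_mul hr hd2 (by positivity) (lurothRatio_pos (hd 0)).le
  linarith

lemma lurothPoint_sub (n : ℕ) : ∀ {d e : ℕ → ℕ}, (∀ i, 2 ≤ d i) → (∀ i, 2 ≤ e i) →
    (∀ i < n, d i = e i) → lurothPoint d - lurothPoint e =
      (∏ i ∈ Finset.range n, lurothRatio (d i)) *
        (lurothPoint (fun i => d (i + n)) - lurothPoint (fun i => e (i + n))) := by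
  induction n with
  | zero => intro d e _ _ _; simp
  | succ n ih =>
    intro d e hd he h
    have h' := ih (d := fun i => d (i + 1)) (e := fun i => e (i + 1)) (fun i => hd _)
      (fun i => he _) (fun i hi => h _ (by omega))
    rw [lurothPoint_eq hd, lurothPoint_eq he, ← h 0 (by omega), Finset.prod_range_succ']
    simp only [add_assoc] at h'
    linear_combination lurothRatio (d 0) * h'

/-- Points with digits bounded by `M` first differing at index `n` are separated by
a definite proportion of their common cylinder. -/
lemma lurothPoint_separated {d e : ℕ → ℕ} (hd : ∀ i, 2 ≤ d i) (he : ∀ i, 2 ≤ e i) {M : ℕ}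
    (hdM : ∀ i, d i ≤ M) (heM : ∀ i, e i ≤ M) {n : ℕ} (h : ∀ i < n, d i = e i)
    (hn : d n ≠ e n) :
    (∏ i ∈ Finset.range n, lurothRatio (d i)) * (1 / (M : ℝ) ^ 3) ≤
      |lurothPoint d - lurothPoint e| := by
  have hp : 0 ≤ ∏ i ∈ Finset.range n, lurothRatio (d i) :=
    Finset.prod_nonneg fun i _ => (lurothRatio_pos (hd i)).le
  rw [lurothPoint_sub n hd he h, abs_mul, abs_of_nonneg hp]
  refine mul_le_mul_of_nonneg_left ?_ hp
  rcases lt_or_gt_of_ne hn with h | h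
  · exact (lurothPoint_separated_zero (d := fun i => d (i + n)) (e := fun i => e (i + n))
      (fun _ => hd _) (fun _ => he _) (fun _ => hdM _) (by simpa using h)).trans (le_abs_self _)
  · rw [abs_sub_comm]
    exact (lurothPoint_separated_zero (d := fun i => e (i + n)) (e := fun i => d (i + n))
      (fun _ => he _) (fun _ => hd _) (fun _ => heM _) (by simpa using h)).trans (le_abs_self _)

lemma le_dimH_image_of_abs_sub_le {f : ℝ → ℝ} {K t : ℝ} (ht : 0 < t)
    (h : ∀ y ∈ Ico (0 : ℝ) 1, ∀ y' ∈ Ico (0 : ℝ) 1, |y - y'| ≤ K * |f y - f y'| ^ t) :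
    ENNReal.ofReal t ≤ dimH (f '' Ico (0 : ℝ) 1) := by
  have hinj : InjOn f (Ico (0 : ℝ) 1) := by
    intro y hy y' hy' hyy
    have := h y hy y' hy'
    rw [hyy, sub_self, abs_zero, Real.zero_rpow ht.ne', mul_zero] at this
    exact sub_eq_zero.1 (abs_eq_zero.1 (le_antisymm this (abs_nonneg _)))
  set g := Function.invFunOn f (Ico (0 : ℝ) 1) with hg
  have hgf : ∀ y ∈ Ico (0 : ℝ) 1, g (f y) = y := fun y hy => hinj.leftInvOn_invFunOn hy
  have himg : g '' (f '' Ico (0 : ℝ) 1) = Ico (0 : ℝ) 1 := by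
    rw [image_image]
    exact (image_congr hgf).trans (image_id' _)
  have hH : HolderOnWith K.toNNReal t.toNNReal g (f '' Ico (0 : ℝ) 1) := by
    rintro _ ⟨y, hy, rfl⟩ _ ⟨y', hy', rfl⟩
    rw [hgf y hy, hgf y' hy', edist_dist, edist_dist, Real.dist_eq, Real.dist_eq,
      Real.coe_toNNReal _ ht.le, ENNReal.ofReal_rpow_of_nonneg (abs_nonneg _) ht.le]
    change _ ≤ ENNReal.ofReal K * _
    rw [← ENNReal.ofReal_mul' (by positivity)]
    exact ENNReal.ofReal_le_ofReal (h y hy y' hy')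
  have h1 := hH.dimH_image_le (Real.toNNReal_pos.2 ht)
  have h2 : dimH (Ico (0 : ℝ) 1) = 1 := by
    rw [Real.dimH_of_nonempty_interior (by rw [interior_Ico]; exact nonempty_Ioo.2 one_pos)]
    simp
  rw [himg, h2, ENNReal.le_div_iff_mul_le (Or.inl (by simpa using ht)) (Or.inl (by simp)),
    one_mul] at h1
  exact h1

/-- The half-open unit interval is the disjoint union of copies of itself scaled by a
probability vector. -/
lemma exists_coding {p : ℕ → ℝ} {N : ℕ} (hp : ∀ k < N, 0 < p k)
    (hsum : ∑ k ∈ Finset.range N, p k = 1) {y : ℝ} (hy : y ∈ Ico (0 : ℝ) 1) :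
    ∃ k < N, ∃ z ∈ Ico (0 : ℝ) 1, y = ∑ j ∈ Finset.range k, p j + p k * z := by
  have hex : ∃ n, y < ∑ j ∈ Finset.range n, p j := ⟨N, hsum ▸ hy.2⟩
  classical
  have hf := Nat.find_spec hex
  have h0 : Nat.find hex ≠ 0 := fun h => by
    rw [h, Finset.sum_range_zero] at hf
    exact absurd hf (not_lt.2 hy.1)
  obtain ⟨k, hk⟩ := Nat.exists_eq_succ_of_ne_zero h0
  have hkN : k < N := by
    have : Nat.find hex ≤ N := Nat.find_le (hsum ▸ hy.2)
    omega
  have hlow : ∑ j ∈ Finset.range k, p j ≤ y := not_lt.1 (Nat.find_min hex (by omega))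
  rw [hk, Finset.sum_range_succ] at hf
  have hpk := hp k hkN
  refine ⟨k, hkN, (y - ∑ j ∈ Finset.range k, p j) / p k, ⟨div_nonneg (by linarith) hpk.le, ?_⟩, ?_⟩
  · rw [div_lt_one hpk]; linarith
  · field_simp; ring

/-- The cost of a prescribed digit, compared with the gain `u` of a free digit. -/
noncomputable def digitWeight (u : ℝ) : Option ℕ → ℝ
  | none => -u
  | some a => if a = 2 then 1 else 3

/-- The points whose Lüroth digits agree with the partial prescription `v`. -/
def prescribedSet (v : ℕ → Option ℕ) : Set ℝ :=
  {x | ∃ d : ℕ → ℕ, (∀ i, 2 ≤ d i) ∧ (∀ i a, v i = some a → d i = a) ∧ x = lurothPoint d}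

lemma one_le_prescribed {t : ℝ} (ht : 0 < t) (u : ℝ) {a : ℕ} (ha : a = 2 ∨ a = 3) :
    1 ≤ 2 ^ (t * digitWeight u (some a)) * lurothRatio a ^ t := by
  rcases ha with rfl | rfl
  · have : lurothRatio 2 = 2⁻¹ := by norm_num [lurothRatio]
    rw [this, Real.inv_rpow zero_le_two]
    simp only [digitWeight, if_true, mul_one]
    rw [mul_inv_cancel₀ (by positivity)]
  · have h : lurothRatio 3 = 1 / 6 := by norm_num [lurothRatio]
    have h2 : (2 : ℝ) ^ (t * digitWeight u (some 3)) = 8 ^ t := by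
      have : digitWeight u (some 3) = 3 := by norm_num [digitWeight]
      rw [this, mul_comm, Real.rpow_mul zero_le_two]
      norm_num
    rw [h, h2, ← Real.mul_rpow (by norm_num) (by norm_num)]
    exact Real.one_le_rpow (by norm_num) ht.le

lemma le_dimH_prescribedSet {u t C : ℝ} (ht : 0 < t) {N : ℕ} {p : ℕ → ℝ} (hp : ∀ k < N, 0 < p k)
    (hsum : ∑ k ∈ Finset.range N, p k = 1)
    (hbound : ∀ k < N, p k ≤ 2 ^ (t * (-u)) * lurothRatio (k + 2) ^ t)
    {v : ℕ → Option ℕ} (hv : ∀ i a, v i = some a → a = 2 ∨ a = 3)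
    (hcost : ∀ n, ∑ i ∈ Finset.range n, digitWeight u (v i) ≤ C) :
    ENNReal.ofReal t ≤ dimH (prescribedSet v) := by
  classical
  have hcod : ∀ y : ℝ, ∃ kz : ℕ × ℝ, y ∈ Ico (0 : ℝ) 1 → kz.1 < N ∧ kz.2 ∈ Ico (0 : ℝ) 1 ∧
      y = ∑ j ∈ Finset.range kz.1, p j + p kz.1 * kz.2 := by
    intro y
    by_cases hy : y ∈ Ico (0 : ℝ) 1
    · obtain ⟨k, hk, z, hz, h⟩ := exists_coding hp hsum hy
      exact ⟨(k, z), fun _ => ⟨hk, hz, h⟩⟩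
    · exact ⟨(0, 0), fun h => absurd h hy⟩
  choose kz hkz using hcod
  let st : ℝ → ℕ → ℝ := fun y n =>
    Nat.rec y (fun n z => if v n = none then (kz z).2 else z) n
  have st_zero : ∀ y, st y 0 = y := fun _ => rfl
  have st_succ : ∀ y n, st y (n + 1) = if v n = none then (kz (st y n)).2 else st y n :=
    fun _ _ => rfl
  have st_mem : ∀ y ∈ Ico (0 : ℝ) 1, ∀ n, st y n ∈ Ico (0 : ℝ) 1 := by
    intro y hy n
    induction n with
    | zero => exact hy
    | succ n ih =>
      rw [st_succ]
      split_ifs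
      · exact (hkz _ ih).2.1
      · exact ih
  let e : ℝ → ℕ → ℕ := fun y n => (v n).getD ((kz (st y n)).1 + 2)
  have e_none : ∀ y n, v n = none → e y n = (kz (st y n)).1 + 2 := fun y n h => by simp [e, h]
  have e_some : ∀ y n a, v n = some a → e y n = a := fun y n a h => by simp [e, h]
  have e_two : ∀ y n, 2 ≤ e y n := by
    intro y n
    rcases h : v n with _ | a
    · rw [e_none y n h]; omega
    · rw [e_some y n a h]; rcases hv n a h with rfl | rfl <;> norm_num
  have e_le : ∀ y ∈ Ico (0 : ℝ) 1, ∀ n, e y n ≤ N + 3 := by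
    intro y hy n
    rcases h : v n with _ | a
    · rw [e_none y n h]; have := (hkz _ (st_mem y hy n)).1; omega
    · rw [e_some y n a h]; rcases hv n a h with rfl | rfl <;> omega
  have hratio : ∀ y n, 0 ≤ ∏ i ∈ Finset.range n, lurothRatio (e y i) := fun y n =>
    Finset.prod_nonneg fun i _ => (lurothRatio_pos (e_two y i)).le
  have step : ∀ y ∈ Ico (0 : ℝ) 1, ∀ y' ∈ Ico (0 : ℝ) 1, ∀ n, e y n = e y' n →
      |st y n - st y' n| ≤ 2 ^ (t * digitWeight u (v n)) * lurothRatio (e y n) ^ t *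
        |st y (n + 1) - st y' (n + 1)| := by
    intro y hy y' hy' n hn
    rw [st_succ, st_succ]
    rcases h : v n with _ | a
    · rw [if_pos rfl, if_pos rfl]
      rw [e_none y n h, e_none y' n h] at hn
      obtain ⟨h1, h2, h3⟩ := hkz _ (st_mem y hy n)
      obtain ⟨h1', h2', h3'⟩ := hkz _ (st_mem y' hy' n)
      have hk : (kz (st y' n)).1 = (kz (st y n)).1 := by omega
      rw [hk] at h3'
      have hs : st y n - st y' n =
          p (kz (st y n)).1 * ((kz (st y n)).2 - (kz (st y' n)).2) := by
        rw [mul_sub]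
        linear_combination h3 - h3'
      rw [hs, abs_mul, abs_of_pos (hp _ h1), e_none y n h]
      exact mul_le_mul_of_nonneg_right (hbound _ h1) (abs_nonneg _)
    · rw [if_neg (by simp), if_neg (by simp), e_some y n a h]
      exact le_mul_of_one_le_left (abs_nonneg _) (one_le_prescribed ht u (hv n a h))
  have main : ∀ y ∈ Ico (0 : ℝ) 1, ∀ y' ∈ Ico (0 : ℝ) 1, ∀ n, (∀ i < n, e y i = e y' i) →
      |y - y'| ≤ 2 ^ (t * ∑ i ∈ Finset.range n, digitWeight u (v i)) *
        (∏ i ∈ Finset.range n, lurothRatio (e y i)) ^ t * |st y n - st y' n| := by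
    intro y hy y' hy' n
    induction n with
    | zero => intro _; simp [st_zero]
    | succ n ih =>
      intro hn
      refine (ih fun i hi => hn i (by omega)).trans ?_
      have h1 := step y hy y' hy' n (hn n (by omega))
      rw [Finset.sum_range_succ, Finset.prod_range_succ, mul_add,
        Real.rpow_add two_pos, Real.mul_rpow (hratio y n) (lurothRatio_pos (e_two y n)).le]
      refine (mul_le_mul_of_nonneg_left h1
        (mul_nonneg (by positivity) (Real.rpow_nonneg (hratio y n) t))).trans (le_of_eq ?_)
      ring
  have main' : ∀ y ∈ Ico (0 : ℝ) 1, ∀ y' ∈ Ico (0 : ℝ) 1, ∀ n, (∀ i < n, e y i = e y' i) →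
      |y - y'| ≤ 2 ^ (t * C) * (∏ i ∈ Finset.range n, lurothRatio (e y i)) ^ t := by
    intro y hy y' hy' n hn
    have h1 : |st y n - st y' n| ≤ 1 := by
      have a := st_mem y hy n
      have b := st_mem y' hy' n
      rw [abs_le]
      constructor <;> linarith [a.1, a.2, b.1, b.2]
    have h2 : (2 : ℝ) ^ (t * ∑ i ∈ Finset.range n, digitWeight u (v i)) ≤ 2 ^ (t * C) :=
      Real.rpow_le_rpow_of_exponent_le one_le_two (mul_le_mul_of_nonneg_left (hcost n) ht.le)
    have h3 := Real.rpow_nonneg (hratio y n) t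
    calc |y - y'| ≤ _ := main y hy y' hy' n hn
      _ ≤ 2 ^ (t * ∑ i ∈ Finset.range n, digitWeight u (v i)) *
        (∏ i ∈ Finset.range n, lurothRatio (e y i)) ^ t :=
          mul_le_of_le_one_right (mul_nonneg (by positivity) h3) h1
      _ ≤ _ := mul_le_mul_of_nonneg_right h2 h3
  have hsub : (fun y => lurothPoint (e y)) '' Ico (0 : ℝ) 1 ⊆ prescribedSet v := by
    rintro _ ⟨y, -, rfl⟩
    exact ⟨e y, e_two y, fun i a => e_some y i a, rfl⟩
  refine le_trans ?_ (dimH_mono hsub)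
  have hM : (0 : ℝ) < ((N + 3 : ℕ) : ℝ) ^ 3 := by positivity
  refine le_dimH_image_of_abs_sub_le (K := 2 ^ (t * C) * (((N + 3 : ℕ) : ℝ) ^ 3) ^ t) ht ?_
  intro y hy y' hy'
  by_cases hee : ∃ n, e y n ≠ e y' n
  · have hmin : ∀ i < Nat.find hee, e y i = e y' i := fun i hi => not_not.1 (Nat.find_min hee hi)
    have h1 := lurothPoint_separated (e_two y) (e_two y') (e_le y hy) (e_le y' hy') hmin
      (Nat.find_spec hee)
    have h2 := main' y hy y' hy' _ hmin
    set P := ∏ i ∈ Finset.range (Nat.find hee), lurothRatio (e y i) with hP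
    have h3 : P ≤ ((N + 3 : ℕ) : ℝ) ^ 3 * |lurothPoint (e y) - lurothPoint (e y')| := by
      rw [mul_one_div, div_le_iff₀ hM] at h1
      linarith
    have h4 := Real.rpow_le_rpow (hratio y _) h3 ht.le
    rw [Real.mul_rpow hM.le (abs_nonneg _)] at h4
    rw [mul_assoc]
    exact h2.trans (mul_le_mul_of_nonneg_left h4 (by positivity))
  · push Not at hee
    have hle : ∀ n : ℕ, |y - y'| ≤ 2 ^ (t * C) * ((1 / 2 : ℝ) ^ t) ^ n := by
      intro n
      refine (main' y hy y' hy' n fun i _ => hee i).trans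
        (mul_le_mul_of_nonneg_left ?_ (by positivity))
      rw [← Real.rpow_natCast, ← Real.rpow_mul (by norm_num), mul_comm, Real.rpow_mul (by norm_num),
        Real.rpow_natCast]
      refine Real.rpow_le_rpow (hratio y n) ?_ ht.le
      calc ∏ i ∈ Finset.range n, lurothRatio (e y i) ≤ ∏ i ∈ Finset.range n, (1 / 2 : ℝ) :=
            Finset.prod_le_prod (fun i _ => (lurothRatio_pos (e_two y i)).le)
              fun i _ => lurothRatio_le_half (e_two y i)
        _ = _ := by simp
    have hlim : Tendsto (fun n : ℕ => (2 : ℝ) ^ (t * C) * ((1 / 2 : ℝ) ^ t) ^ n) atTop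
        (nhds (2 ^ (t * C) * 0)) :=
      (tendsto_pow_atTop_nhds_zero_of_lt_one (by positivity)
        (Real.rpow_lt_one (by norm_num) (by norm_num) ht)).const_mul _
    rw [mul_zero] at hlim
    exact (ge_of_tendsto' hlim hle).trans (by positivity)

/-- The truncated series at an exponent below the critical one exceeds `1`. -/
lemma exists_one_le_sum {u s t : ℝ} (hu : 0 ≤ u) (hs : lurothF u s = 1) (hts : t < s) :
    ∃ N : ℕ, 1 ≤ ∑ k ∈ Finset.range N,
      (1 / (2 ^ u * ((k : ℝ) + 2) * ((k : ℝ) + 1))) ^ t := by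
  have hsm : Summable fun k : ℕ => (1 / (2 ^ u * ((k : ℝ) + 2) * ((k : ℝ) + 1))) ^ s := by
    by_contra h
    rw [lurothF, tsum_eq_zero_of_not_summable h] at hs
    exact zero_ne_one hs
  have hlim := hsm.hasSum.tendsto_sum_nat
  change Tendsto _ _ (nhds (lurothF u s)) at hlim
  rw [hs] at hlim
  have h2 : (2 : ℝ) ^ (t - s) < 1 := Real.rpow_lt_one_of_one_lt_of_neg one_lt_two (by linarith)
  obtain ⟨N, hN⟩ := (hlim.eventually (lt_mem_nhds h2)).exists
  refine ⟨N, ?_⟩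
  have hterm : ∀ k : ℕ, 2 ^ (s - t) * (1 / (2 ^ u * ((k : ℝ) + 2) * ((k : ℝ) + 1))) ^ s ≤
      (1 / (2 ^ u * ((k : ℝ) + 2) * ((k : ℝ) + 1))) ^ t := by
    intro k
    set x := 2 ^ u * ((k : ℝ) + 2) * ((k : ℝ) + 1) with hx
    have h1 : (1 : ℝ) ≤ 2 ^ u := Real.one_le_rpow one_le_two hu
    have hk : (0 : ℝ) ≤ k := Nat.cast_nonneg k
    have hx2 : 2 ≤ x := by
      have : 2 ≤ 2 ^ u * ((k : ℝ) + 2) := by nlinarith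
      nlinarith
    have hx0 : 0 < 1 / x := by positivity
    have e : (1 / x) ^ s = (1 / x) ^ t * (x ^ (s - t))⁻¹ := by
      rw [← Real.inv_rpow (by linarith), ← one_div, ← Real.rpow_add hx0]
      congr 1
      ring
    have h3 : (2 : ℝ) ^ (s - t) ≤ x ^ (s - t) :=
      Real.rpow_le_rpow zero_le_two hx2 (by linarith)
    have h4 : 0 < x ^ (s - t) := Real.rpow_pos_of_pos (by linarith) _
    rw [e, mul_left_comm]
    refine mul_le_of_le_one_right (Real.rpow_nonneg hx0.le _) ?_
    rw [← div_eq_mul_inv, div_le_one h4]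
    exact h3
  calc (1 : ℝ) = 2 ^ (s - t) * 2 ^ (t - s) := by
        rw [← Real.rpow_add two_pos]; simp
    _ ≤ 2 ^ (s - t) * _ := mul_le_mul_of_nonneg_left hN.le (by positivity)
    _ ≤ _ := by
      rw [Finset.mul_sum]
      exact Finset.sum_le_sum fun k _ => hterm k

lemma le_dimH_prescribedSet_of_lurothF {u u' s t C : ℝ} (hu : 0 ≤ u) (hs : lurothF u s = 1)
    (ht : 0 < t) {s' : ℝ} (hts' : t ≤ s') (hs's : s' < s) (huu : t * u' ≤ s' * u)
    {v : ℕ → Option ℕ} (hv : ∀ i a, v i = some a → a = 2 ∨ a = 3)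
    (hcost : ∀ n, ∑ i ∈ Finset.range n, digitWeight u' (v i) ≤ C) :
    ENNReal.ofReal t ≤ dimH (prescribedSet v) := by
  obtain ⟨N, hN⟩ := exists_one_le_sum hu hs hs's
  set q : ℕ → ℝ := fun k => (1 / (2 ^ u * ((k : ℝ) + 2) * ((k : ℝ) + 1))) ^ s' with hq
  set Z := ∑ k ∈ Finset.range N, q k with hZ
  have hZ0 : 0 < Z := by linarith
  have hq0 : ∀ k, 0 < q k := fun k => by positivity
  refine le_dimH_prescribedSet (N := N) (p := fun k => q k / Z) ht (fun k _ => div_pos (hq0 k) hZ0) ?_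
    (fun k _ => ?_) hv hcost
  · rw [← Finset.sum_div, div_self hZ0.ne']
  · refine (div_le_self (hq0 k).le hN).trans ?_
    have e : 1 / (2 ^ u * ((k : ℝ) + 2) * ((k : ℝ) + 1)) = 2 ^ (-u) * lurothRatio (k + 2) := by
      rw [Real.rpow_neg zero_le_two]
      unfold lurothRatio
      push_cast
      have : (k : ℝ) + 2 - 1 = k + 1 := by ring
      rw [this]
      field_simp
    have hr := lurothRatio_pos (k := k + 2) (by omega)
    simp only [hq]
    rw [e, Real.mul_rpow (by positivity) hr.le, ← Real.rpow_mul zero_le_two]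
    refine mul_le_mul ?_ ?_ (by positivity) (by positivity)
    · exact Real.rpow_le_rpow_of_exponent_le one_le_two (by linarith)
    · exact Real.rpow_le_rpow_of_exponent_ge hr
        ((lurothRatio_le_half (by omega)).trans (by norm_num)) hts'

lemma runLen_le {d : ℕ → ℕ} {x : ℝ} (hx : ∀ n, lurothD (n + 1) x = d n) {N B : ℕ}
    (h : ∀ j k, j + k ≤ N → (∀ i < k, d (j + i) = d j) → k ≤ B) : runLen N x ≤ B := by
  refine csSup_le' ?_
  rintro k ⟨-, j, hj, hd⟩
  refine h j k hj fun i hi => ?_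
  have := hd (i + 1) (by omega) (by omega)
  rwa [← add_assoc, hx, hx] at this

lemma le_runLen {d : ℕ → ℕ} {x : ℝ} (hx : ∀ n, lurothD (n + 1) x = d n) {N j k : ℕ}
    (hj : j + k ≤ N) (h : ∀ i < k, d (j + i) = d j) : k ≤ runLen N x := by
  rcases Nat.eq_zero_or_pos k with rfl | hk
  · exact Nat.zero_le _
  · refine le_csSup ⟨N, ?_⟩ ⟨hk, j, hj, fun i hi hik => ?_⟩
    · rintro k ⟨-, j, hj, -⟩
      omega
    · obtain ⟨i, rfl⟩ := Nat.exists_eq_succ_of_ne_zero (by omega : i ≠ 0)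
      rw [Nat.succ_eq_add_one, ← add_assoc, hx, hx]
      exact h i (by omega)

/-- Block `j` lies in one of the runs `[a k, b k)`. -/
def InRun (a b : ℕ → ℕ) (j : ℕ) : Prop := ∃ k, a k ≤ j ∧ j < b k

open Classical in
/-- The prescribed digits: in blocks of length `L`, the blocks of a run consist of `2`s preceded by
a single `3`, and every other block starts with `3, 2` followed by free digits. -/
noncomputable def blockPattern (L : ℕ) (a b : ℕ → ℕ) (i : ℕ) : Option ℕ :=
  if InRun a b (i / L) then
    if i % L = 0 ∧ ∃ k, i / L = a k then some 3 else some 2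
  else if i % L = 0 then some 3 else if i % L = 1 then some 2 else none

lemma blockPattern_eq_two_or_three {L : ℕ} {a b : ℕ → ℕ} (i c : ℕ)
    (h : blockPattern L a b i = some c) : c = 2 ∨ c = 3 := by
  unfold blockPattern at h
  split_ifs at h <;> simp_all

section Blocks

variable {a b : ℕ → ℕ}

lemma monotone_left (hab : ∀ k, a k < b k) (hba : ∀ k, b k ≤ a (k + 1)) : Monotone a :=
  monotone_nat_of_le_succ fun k => (hab k).le.trans (hba k)

lemma strictMono_right (hab : ∀ k, a k < b k) (hba : ∀ k, b k ≤ a (k + 1)) : StrictMono b :=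
  strictMono_nat_of_lt_succ fun k => (hba k).trans_lt (hab _)

lemma right_le_left (hab : ∀ k, a k < b k) (hba : ∀ k, b k ≤ a (k + 1)) {k m : ℕ}
    (h : k < m) : b k ≤ a m :=
  (hba k).trans (monotone_left hab hba h)

lemma not_inRun_of_lt (hab : ∀ k, a k < b k) (hba : ∀ k, b k ≤ a (k + 1)) {j : ℕ}
    (h : j < a 0) : ¬ InRun a b j := by
  rintro ⟨m, hm, -⟩
  have := monotone_left hab hba (Nat.zero_le m)
  omega

lemma not_inRun_between (hab : ∀ k, a k < b k) (hba : ∀ k, b k ≤ a (k + 1)) {j k : ℕ}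
    (h1 : b k ≤ j) (h2 : j < a (k + 1)) : ¬ InRun a b j := by
  rintro ⟨m, hm, hm'⟩
  rcases Nat.lt_or_ge k m with h | h
  · have := monotone_left hab hba (Nat.succ_le_of_lt h)
    simp only [Nat.succ_eq_add_one] at this
    omega
  · have := (strictMono_right hab hba).monotone h
    omega

variable {L : ℕ} {d : ℕ → ℕ}

lemma digit_eq_two_of_run (hab : ∀ k, a k < b k) (hba : ∀ k, b k ≤ a (k + 1)) (hL : 3 ≤ L)
    (hd : ∀ i c, blockPattern L a b i = some c → d i = c) {k i : ℕ} (h1 : L * a k < i)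
    (h2 : i < L * b k) : d i = 2 := by
  have hl : a k ≤ i / L := by
    rw [Nat.le_div_iff_mul_le (by omega), mul_comm]
    exact h1.le
  have hr : i / L < b k := by
    rw [Nat.div_lt_iff_lt_mul (by omega), mul_comm]
    exact h2
  refine hd i 2 ?_
  unfold blockPattern
  rw [if_pos ⟨k, hl, hr⟩, if_neg]
  rintro ⟨h0, m, hm⟩
  have hi : i = L * a m := by
    have := Nat.div_add_mod i L
    rw [h0, hm] at this
    omega
  have hne : a k < a m := by
    rw [hi] at h1
    exact Nat.lt_of_mul_lt_mul_left h1
  have hkm : k < m := (monotone_left hab hba).reflect_lt hne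
  have := right_le_left hab hba hkm
  omega

lemma digit_eq_three_left (hab : ∀ k, a k < b k) (hL : 3 ≤ L)
    (hd : ∀ i c, blockPattern L a b i = some c → d i = c) (k : ℕ) : d (L * a k) = 3 := by
  refine hd _ 3 ?_
  unfold blockPattern
  rw [Nat.mul_div_cancel_left _ (by omega), if_pos ⟨k, le_rfl, hab k⟩,
    if_pos ⟨Nat.mul_mod_right _ _, k, rfl⟩]

lemma digit_eq_three_of_not_inRun (hL : 3 ≤ L)
    (hd : ∀ i c, blockPattern L a b i = some c → d i = c) {j : ℕ} (hj : ¬ InRun a b j) :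
    d (L * j) = 3 := by
  refine hd _ 3 ?_
  unfold blockPattern
  rw [Nat.mul_div_cancel_left _ (by omega), if_neg hj, if_pos (Nat.mul_mod_right _ _)]

lemma digit_eq_two_of_not_inRun (hL : 3 ≤ L)
    (hd : ∀ i c, blockPattern L a b i = some c → d i = c) {j : ℕ} (hj : ¬ InRun a b j) :
    d (L * j + 1) = 2 := by
  refine hd _ 2 ?_
  have h1 : (L * j + 1) / L = j := by
    rw [Nat.mul_add_div (by omega), Nat.div_eq_of_lt (by omega), add_zero]
  have h2 : (L * j + 1) % L = 1 := by
    rw [Nat.mul_add_mod, Nat.mod_eq_of_lt (by omega)]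
  unfold blockPattern
  rw [h1, h2, if_neg hj, if_neg one_ne_zero, if_pos rfl]

lemma digit_eq_three_right (hab : ∀ k, a k < b k) (hba : ∀ k, b k ≤ a (k + 1)) (hL : 3 ≤ L)
    (hd : ∀ i c, blockPattern L a b i = some c → d i = c) (k : ℕ) : d (L * b k) = 3 := by
  rcases (hba k).lt_or_eq with h | h
  · exact digit_eq_three_of_not_inRun hL hd (not_inRun_between hab hba le_rfl h)
  · rw [h]
    exact digit_eq_three_left hab hL hd _

lemma constant_stretch_le (hab : ∀ k, a k < b k) (hba : ∀ k, b k ≤ a (k + 1)) (hL : 3 ≤ L)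
    (hmono : Monotone fun k => b k - a k)
    (hd : ∀ i c, blockPattern L a b i = some c → d i = c) {j l N : ℕ} (hj : j + l ≤ N)
    (hc : ∀ i < l, d (j + i) = d j) (K : ℕ) :
    l ≤ max (max (2 * L) (L * (b K - a K) - 1)) (N - (L * a (K + 1) + 1)) := by
  by_cases hl : l ≤ 2 * L
  · exact hl.trans ((le_max_left _ _).trans (le_max_left _ _))
  have hconst : ∀ i, j ≤ i → i < j + l → d i = d j := by
    intro i h1 h2
    have := hc (i - j) (by omega)
    rwa [Nat.add_sub_cancel' h1] at this
  set q := j / L + 1 with hq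
  have hq1 : j < L * q := by
    rw [hq]
    exact Nat.lt_mul_div_succ j (by omega)
  have hq2 : L * q ≤ j + L := by
    rw [hq, mul_add, mul_one]
    exact Nat.add_le_add_right (Nat.mul_div_le j L) L
  have e1 := hconst (L * q) hq1.le (by omega)
  have e2 := hconst (L * q + 1) (by omega) (by omega)
  by_cases hr : InRun a b q
  · obtain ⟨m, hm1, hm2⟩ := hr
    have h1 : L * a m ≤ L * q := Nat.mul_le_mul_left L hm1
    have h2 : L * (q + 1) ≤ L * b m := Nat.mul_le_mul_left L hm2
    rw [mul_add, mul_one] at h2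
    have e3 := digit_eq_two_of_run hab hba hL hd (k := m) (i := L * q + 1) (by omega) (by omega)
    have e4 := digit_eq_three_left hab hL hd m
    have e5 := digit_eq_three_right hab hba hL hd m
    have h3 : L * a m < j := by
      by_contra h
      have := hconst (L * a m) (by omega) (by omega)
      omega
    have h4 : j + l ≤ L * b m := by
      by_contra h
      have := hconst (L * b m) (by omega) (by omega)
      omega
    rcases Nat.lt_or_ge K m with h | h
    · refine le_trans ?_ (le_max_right _ _)
      have : L * a (K + 1) ≤ L * a m := Nat.mul_le_mul_left L (monotone_left hab hba h)
      omega
    · refine le_trans ?_ ((le_max_right _ _).trans (le_max_left _ _))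
      have h5 : L * (b m - a m) ≤ L * (b K - a K) := Nat.mul_le_mul_left L (hmono h)
      rw [Nat.mul_sub] at h5
      omega
  · have e3 := digit_eq_three_of_not_inRun hL hd hr
    have e4 := digit_eq_two_of_not_inRun hL hd hr
    omega

end Blocks

lemma eventually_of_forall_between {m : ℕ → ℕ} (hm : Monotone m) (hm' : Tendsto m atTop atTop)
    {P : ℕ → Prop} (h : ∀ᶠ k in atTop, ∀ N, m k < N → N ≤ m (k + 1) → P N) :
    ∀ᶠ N in atTop, P N := by
  obtain ⟨K, hK⟩ := eventually_atTop.1 h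
  filter_upwards [eventually_gt_atTop (m K)] with N hN
  have hex : ∃ k, N ≤ m k := (hm'.eventually_ge_atTop N).exists
  classical
  have h1 := Nat.find_spec hex
  have h2 : K < Nat.find hex := by
    by_contra h3
    have := hm (not_lt.1 h3)
    omega
  obtain ⟨k, hk⟩ := Nat.exists_eq_succ_of_ne_zero (by omega : Nat.find hex ≠ 0)
  rw [hk] at h1
  exact hK k (by omega) N (not_le.1 (Nat.find_min hex (by omega))) h1

/-- Asymptotics of a function which is, up to a constant, the maximal length `r` of the
intervals `[n k, m k)` cut off at `N`. -/
lemma liminf_limsup_of_intervals {f n r m : ℕ → ℕ} {c : ℕ} {α β : ℝ} (hα : 0 ≤ α) (hα1 : α ≤ 1)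
    (hβ : 0 ≤ β)
    (hm : ∀ k, m k = n k + r k) (hmn : ∀ k, m k ≤ n (k + 1))
    (hm' : Tendsto m atTop atTop) (h0 : ∀ N, f N ≤ N) (h1 : ∀ k N, m k ≤ N → r k ≤ f N)
    (h2 : ∀ k N, N ≤ m k → N - n k ≤ f N)
    (h3 : ∀ k N, f N ≤ max (max c (r k)) (N - n (k + 1)))
    (hlβ : Tendsto (fun k => (r k : ℝ) / m k) atTop (nhds β))
    (hlα : Tendsto (fun k => (r k : ℝ) / (n (k + 1) + r k : ℕ)) atTop (nhds α)) :
    liminf (fun N : ℕ => (f N : ℝ) / N) atTop = α ∧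
      limsup (fun N : ℕ => (f N : ℝ) / N) atTop = β := by
  have hmm : Monotone m := monotone_nat_of_le_succ fun k => by
    have := hmn k
    have := hm (k + 1)
    omega
  have hq0 : ∀ N : ℕ, 0 ≤ (f N : ℝ) / N := fun N => by positivity
  have hq1 : ∀ N : ℕ, (f N : ℝ) / N ≤ 1 := fun N =>
    div_le_one_of_le₀ (by exact_mod_cast h0 N) (by positivity)
  have hbl : IsBoundedUnder (· ≥ ·) atTop (fun N : ℕ => (f N : ℝ) / N) :=
    isBoundedUnder_of ⟨0, hq0⟩
  have hbu : IsBoundedUnder (· ≤ ·) atTop (fun N : ℕ => (f N : ℝ) / N) :=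
    isBoundedUnder_of ⟨1, hq1⟩
  have hsum : Tendsto (fun k => n (k + 1) + r k) atTop atTop :=
    tendsto_atTop_mono (fun k => (hmn k).trans (Nat.le_add_right _ _)) hm'
  have hcε : ∀ γ : ℝ, 0 < γ → ∀ᶠ N : ℕ in atTop, (c : ℝ) ≤ γ * N := fun γ hγ =>
    (tendsto_natCast_atTop_atTop.const_mul_atTop hγ).eventually_ge_atTop _
  refine ⟨le_antisymm ?_ ?_, le_antisymm ?_ ?_⟩
  · refine le_of_forall_pos_le_add fun ε hε => liminf_le_of_frequently_le ?_ hbl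
    refine hsum.frequently (p := fun N : ℕ => (f N : ℝ) / N ≤ α + ε) (Eventually.frequently ?_)
    filter_upwards [hlα.eventually (ge_mem_nhds (by linarith : α < α + ε)),
      hsum.eventually (hcε (α + ε) (by linarith)), hsum.eventually_gt_atTop 0] with k hk hc hpos
    have hpos' : (0 : ℝ) < (n (k + 1) + r k : ℕ) := by exact_mod_cast hpos
    rw [div_le_iff₀ hpos'] at hk ⊢
    have h4 := h3 k (n (k + 1) + r k)
    rw [Nat.add_sub_cancel_left, max_assoc, max_self] at h4
    have h5 : (f (n (k + 1) + r k) : ℝ) ≤ max (c : ℝ) (r k) := by exact_mod_cast h4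
    exact h5.trans (max_le hc hk)
  · refine le_of_forall_pos_le_add fun ε hε => ?_
    rw [← sub_le_iff_le_add]
    refine le_liminf_of_le hbu.isCoboundedUnder_ge ?_
    refine eventually_of_forall_between hmm hm' ?_
    filter_upwards [hlα.eventually (le_mem_nhds (by linarith : α - ε < α)),
      hsum.eventually_gt_atTop 0] with k hk hpos N hN1 hN2
    have hpos' : (0 : ℝ) < (n (k + 1) + r k : ℕ) := by exact_mod_cast hpos
    have hN0 : (0 : ℝ) < N := by exact_mod_cast (by omega : 0 < N)
    rcases lt_or_ge (α - ε) 0 with hneg | hnn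
    · exact hneg.le.trans (hq0 N)
    rw [le_div_iff₀ hpos'] at hk
    rw [le_div_iff₀ hN0]
    rcases Nat.lt_or_ge (n (k + 1) + r k) N with h | h
    · have h4 : ((N - n (k + 1) : ℕ) : ℝ) ≤ f N := by exact_mod_cast h2 _ _ hN2
      rw [Nat.cast_sub (by omega)] at h4
      have h5 : ((n (k + 1) + r k : ℕ) : ℝ) ≤ N := by exact_mod_cast h.le
      push_cast at hk h5
      nlinarith
    · have h4 : (r k : ℝ) ≤ f N := by exact_mod_cast h1 k N hN1.le
      have h5 : (N : ℝ) ≤ (n (k + 1) + r k : ℕ) := by exact_mod_cast h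
      exact ((mul_le_mul_of_nonneg_left h5 hnn).trans hk).trans h4
  · refine le_of_forall_pos_le_add fun ε hε => limsup_le_of_le hbl.isCoboundedUnder_le ?_
    filter_upwards [hcε (β + ε) (by linarith), eventually_gt_atTop 0,
      eventually_of_forall_between hmm hm' (P := fun N => ∃ k, m k < N ∧ N ≤ m (k + 1) ∧
        (r k : ℝ) ≤ (β + ε) * m k ∧ (r (k + 1) : ℝ) ≤ (β + ε) * m (k + 1)) (by
          have hev : ∀ᶠ k in atTop, (r k : ℝ) ≤ (β + ε) * m k := by
            filter_upwards [hlβ.eventually (ge_mem_nhds (by linarith : β < β + ε)),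
              hm'.eventually_gt_atTop 0] with k hk hpos
            rwa [div_le_iff₀ (by exact_mod_cast hpos)] at hk
          filter_upwards [hev, (tendsto_add_atTop_nat 1).eventually hev] with k ha hb N h h'
          exact ⟨k, h, h', ha, hb⟩)] with N hc hpos hk
    obtain ⟨k, hk1, hk2, hk3, hk4⟩ := hk
    have hN0 : (0 : ℝ) < N := by exact_mod_cast hpos
    rw [div_le_iff₀ hN0]
    have h5 : (f N : ℝ) ≤ max (max (c : ℝ) (r k)) ((N - n (k + 1) : ℕ) : ℝ) := by
      exact_mod_cast h3 k N
    refine h5.trans (max_le (max_le hc ?_) ?_)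
    · refine hk3.trans (mul_le_mul_of_nonneg_left ?_ (by linarith))
      exact_mod_cast hk1.le
    · rcases Nat.lt_or_ge N (n (k + 1)) with h | h
      · rw [Nat.sub_eq_zero_of_le h.le, Nat.cast_zero]
        positivity
      · rw [Nat.cast_sub h]
        have h6 : (N : ℝ) ≤ m (k + 1) := by exact_mod_cast hk2
        have h7 : (m (k + 1) : ℝ) = n (k + 1) + r (k + 1) := by exact_mod_cast hm (k + 1)
        have h8 : (0 : ℝ) ≤ n (k + 1) := by positivity
        rcases le_total (β + ε) 1 with h9 | h9
        · nlinarith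
        · nlinarith
  · refine le_of_forall_pos_le_add fun ε hε => ?_
    rw [← sub_le_iff_le_add]
    refine le_limsup_of_frequently_le ?_ hbu
    refine hm'.frequently (p := fun N : ℕ => β - ε ≤ (f N : ℝ) / N) (Eventually.frequently ?_)
    filter_upwards [hlβ.eventually (le_mem_nhds (by linarith : β - ε < β))] with k hk
    refine hk.trans (div_le_div_of_nonneg_right ?_ (by positivity))
    exact_mod_cast h1 k (m k) le_rfl

lemma runLen_asymptotics {a b : ℕ → ℕ} (hab : ∀ k, a k < b k) (hba : ∀ k, b k ≤ a (k + 1))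
    {L : ℕ} {d : ℕ → ℕ} (hL : 3 ≤ L) (hmono : Monotone fun k => b k - a k)
    (hd : ∀ i c, blockPattern L a b i = some c → d i = c) {x : ℝ}
    (hx : ∀ n, lurothD (n + 1) x = d n) {α β : ℝ} (hα : 0 ≤ α) (hα1 : α ≤ 1) (hβ : 0 ≤ β)
    (hlβ : Tendsto (fun k => ((b k - a k : ℕ) : ℝ) / b k) atTop (nhds β))
    (hlα : Tendsto (fun k => ((b k - a k : ℕ) : ℝ) / (a (k + 1) + (b k - a k) : ℕ))
      atTop (nhds α)) :
    liminf (fun N : ℕ => (runLen N x : ℝ) / N) atTop = α ∧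
      limsup (fun N : ℕ => (runLen N x : ℝ) / N) atTop = β := by
  have hLp : 0 < L := by omega
  have hc : ∀ k, L ≤ L * (b k - a k) := fun k =>
    Nat.le_mul_of_pos_right L (Nat.sub_pos_of_lt (hab k))
  have hs : ∀ k, L * a k + L * (b k - a k) = L * b k := fun k => by
    rw [← mul_add, Nat.add_sub_cancel' (hab k).le]
  have hb' : Tendsto b atTop atTop := (strictMono_right hab hba).tendsto_atTop
  have hr : ∀ k, ((L * (b k - a k) - 1 : ℕ) : ℝ) = L * ((b k - a k : ℕ) : ℝ) - 1 := fun k => by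
    rw [Nat.cast_sub (by have := hc k; omega)]
    push_cast
    ring
  have hL0 : (L : ℝ) ≠ 0 := by exact_mod_cast hLp.ne'
  refine liminf_limsup_of_intervals (n := fun k => L * a k + 1)
    (r := fun k => L * (b k - a k) - 1) (m := fun k => L * b k) (c := 2 * L) hα hα1 hβ
    (fun k => ?_) (fun k => ?_) ?_ (fun N => ?_) (fun k N h => ?_) (fun k N h => ?_)
    (fun k N => ?_) ?_ ?_
  · have := hc k
    have := hs k
    omega
  · exact (Nat.mul_le_mul_left L (hba k)).trans (Nat.le_succ _)
  · exact tendsto_atTop_mono (fun k => Nat.le_mul_of_pos_left _ hLp) hb'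
  · exact runLen_le hx fun j k hj _ => by omega
  · have := hc k
    have := hs k
    refine le_runLen hx (j := L * a k + 1) (by omega) fun i hi => ?_
    rw [digit_eq_two_of_run hab hba hL hd (k := k) (by omega) (by omega),
      digit_eq_two_of_run hab hba hL hd (k := k) (by omega) (by omega)]
  · rcases Nat.lt_or_ge N (L * a k + 1) with h' | h'
    · rw [Nat.sub_eq_zero_of_le h'.le]
      exact Nat.zero_le _
    refine le_runLen hx (j := L * a k + 1) (by omega) fun i hi => ?_
    rw [digit_eq_two_of_run hab hba hL hd (k := k) (by omega) (by omega),
      digit_eq_two_of_run hab hba hL hd (k := k) (by omega) (by omega)]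
  · exact runLen_le hx fun j l hj h => constant_stretch_le hab hba hL hmono hd hj h k
  · have hbL : Tendsto (fun k => ((L * b k : ℕ) : ℝ)⁻¹) atTop (nhds 0) :=
      tendsto_inv_atTop_zero.comp (tendsto_natCast_atTop_atTop.comp
        (tendsto_atTop_mono (fun k => Nat.le_mul_of_pos_left _ hLp) hb'))
    have := hlβ.sub hbL
    rw [sub_zero] at this
    refine this.congr fun k => ?_
    have hb0 : (b k : ℝ) ≠ 0 := by
      have := hab k
      exact_mod_cast (by omega : b k ≠ 0)
    rw [hr]
    push_cast
    field_simp
  · have hbL : Tendsto (fun k => ((L * (a (k + 1) + (b k - a k)) : ℕ) : ℝ)⁻¹) atTop (nhds 0) := by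
      refine tendsto_inv_atTop_zero.comp (tendsto_natCast_atTop_atTop.comp
        (tendsto_atTop_mono (fun k => ?_) hb'))
      exact ((hba k).trans (Nat.le_add_right _ _)).trans (Nat.le_mul_of_pos_left _ hLp)
    have := hlα.sub hbL
    rw [sub_zero] at this
    refine this.congr fun k => ?_
    have hk := hab k
    have hb0 : ((a (k + 1) + (b k - a k) : ℕ) : ℝ) ≠ 0 := by
      exact_mod_cast (by omega : a (k + 1) + (b k - a k) ≠ 0)
    have e : L * a (k + 1) + 1 + (L * (b k - a k) - 1) = L * (a (k + 1) + (b k - a k)) := by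
      have := hc k
      rw [mul_add]
      omega
    simp only [e, hr]
    rw [Nat.cast_mul]
    field_simp

section Cost

variable {a b : ℕ → ℕ} {L : ℕ} {u w : ℝ}

lemma digitWeight_le_three (hu : 0 ≤ u) (o : Option ℕ) : digitWeight u o ≤ 3 := by
  rcases o with _ | c
  · exact (neg_nonpos.2 hu).trans (by norm_num)
  · unfold digitWeight
    dsimp only
    split_ifs <;> norm_num

open Classical in
/-- The weight of a block, up to normalisation. -/
noncomputable def blockWeight (w : ℝ) (a b : ℕ → ℕ) (j : ℕ) : ℝ :=
  if InRun a b j then 1 else -w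

lemma sum_digitWeight_block_le (hL : 3 ≤ L) (hu : 0 ≤ u)
    (huw : w * (L + 2) ≤ u * (L - 2) - 4) (j : ℕ) :
    ∑ r ∈ Finset.range L, digitWeight u (blockPattern L a b (L * j + r)) ≤
      (L + 2) * blockWeight w a b j := by
  obtain ⟨l, rfl⟩ : ∃ l, L = l + 2 := ⟨L - 2, by omega⟩
  have hdiv : ∀ r < l + 2, ((l + 2) * j + r) / (l + 2) = j := fun r hr => by
    rw [Nat.mul_add_div (by omega), Nat.div_eq_of_lt hr, add_zero]
  have hmod : ∀ r < l + 2, ((l + 2) * j + r) % (l + 2) = r := fun r hr => by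
    rw [Nat.mul_add_mod, Nat.mod_eq_of_lt hr]
  push_cast at huw ⊢
  by_cases hj : InRun a b j
  · rw [Finset.sum_range_succ']
    have h1 : ∑ r ∈ Finset.range (l + 1),
        digitWeight u (blockPattern (l + 2) a b ((l + 2) * j + (r + 1))) ≤
        ∑ r ∈ Finset.range (l + 1), (1 : ℝ) := by
      refine Finset.sum_le_sum fun r hr => ?_
      have hr' : r + 1 < l + 2 := by
        have := Finset.mem_range.1 hr
        omega
      unfold blockPattern
      rw [hdiv _ hr', hmod _ hr', if_pos hj, if_neg (by simp)]
      simp [digitWeight]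
    have h2 := digitWeight_le_three hu (blockPattern (l + 2) a b ((l + 2) * j + 0))
    simp only [Finset.sum_const, Finset.card_range, nsmul_eq_mul, mul_one] at h1
    push_cast at h1
    unfold blockWeight
    rw [if_pos hj]
    linarith
  · rw [Finset.sum_range_succ', Finset.sum_range_succ']
    have h1 : ∑ r ∈ Finset.range l,
        digitWeight u (blockPattern (l + 2) a b ((l + 2) * j + (r + 1 + 1))) =
        ∑ r ∈ Finset.range l, (-u) := by
      refine Finset.sum_congr rfl fun r hr => ?_
      have hr' : r + 1 + 1 < l + 2 := by
        have := Finset.mem_range.1 hr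
        omega
      unfold blockPattern
      rw [hdiv _ hr', hmod _ hr', if_neg hj, if_neg (by omega), if_neg (by omega)]
      rfl
    have h2 := digitWeight_le_three hu (blockPattern (l + 2) a b ((l + 2) * j + 0))
    have h3 : digitWeight u (blockPattern (l + 2) a b ((l + 2) * j + (0 + 1))) = 1 := by
      unfold blockPattern
      rw [hdiv _ (by omega), hmod _ (by omega), if_neg hj, if_neg (by omega), if_pos (by omega)]
      simp [digitWeight]
    simp only [Finset.sum_const, Finset.card_range, nsmul_eq_mul] at h1
    unfold blockWeight
    rw [if_neg hj, h1, h3]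
    linarith

lemma sum_digitWeight_le (hL : 3 ≤ L) (hu : 0 ≤ u)
    (huw : w * (L + 2) ≤ u * (L - 2) - 4)
    (hblock : ∀ J, ∑ j ∈ Finset.range J, blockWeight w a b j ≤ 0) (n : ℕ) :
    ∑ i ∈ Finset.range n, digitWeight u (blockPattern L a b i) ≤ 3 * L := by
  have h1 : ∀ J, ∑ i ∈ Finset.range (L * J), digitWeight u (blockPattern L a b i) ≤
      (L + 2) * ∑ j ∈ Finset.range J, blockWeight w a b j := by
    intro J
    induction J with
    | zero => simp
    | succ J ih =>
      rw [mul_add, mul_one, Finset.sum_range_add, Finset.sum_range_succ, mul_add]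
      exact add_le_add ih (sum_digitWeight_block_le hL hu huw J)
  rw [← Nat.div_add_mod n L, Finset.sum_range_add]
  have h2 : ∑ i ∈ Finset.range (n % L),
      digitWeight u (blockPattern L a b (L * (n / L) + i)) ≤
      ∑ i ∈ Finset.range (n % L), (3 : ℝ) :=
    Finset.sum_le_sum fun _ _ => digitWeight_le_three hu _
  have h3 : ((n % L : ℕ) : ℝ) ≤ L := by exact_mod_cast (Nat.mod_lt n (by omega)).le
  have h4 : ((L : ℝ) + 2) * ∑ j ∈ Finset.range (n / L), blockWeight w a b j ≤ 0 :=
    mul_nonpos_of_nonneg_of_nonpos (by positivity) (hblock _)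
  have h5 := h1 (n / L)
  simp only [Finset.sum_const, Finset.card_range, nsmul_eq_mul] at h2
  linarith

lemma sum_blockWeight_nonpos_step (hw : 0 ≤ w) {p q s : ℕ} (hpq : p ≤ q)
    (h0 : ∑ j ∈ Finset.range p, blockWeight w a b j ≤ 0)
    (hfree : ∀ j, p ≤ j → j < q → ¬ InRun a b j) (hrun : ∀ j, q ≤ j → j < s → InRun a b j)
    (hcost : (s : ℝ) - q ≤ w * (q - p)) {J : ℕ} (hpJ : p ≤ J) (hJs : J ≤ s) :
    ∑ j ∈ Finset.range J, blockWeight w a b j ≤ 0 := by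
  have hF : ∀ J, p ≤ J → J ≤ q → ∑ j ∈ Finset.range J, blockWeight w a b j =
      ∑ j ∈ Finset.range p, blockWeight w a b j - w * (J - p) := by
    intro J hJ
    induction J, hJ using Nat.le_induction with
    | base => intro _; simp
    | succ J hJ ih =>
      intro hJq
      rw [Finset.sum_range_succ, ih (by omega), blockWeight, if_neg (hfree J hJ (by omega))]
      push_cast
      ring
  have hR : ∀ J, q ≤ J → J ≤ s → ∑ j ∈ Finset.range J, blockWeight w a b j =
      ∑ j ∈ Finset.range q, blockWeight w a b j + (J - q) := by
    intro J hJ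
    induction J, hJ using Nat.le_induction with
    | base => intro _; simp
    | succ J hJ ih =>
      intro hJq
      rw [Finset.sum_range_succ, ih (by omega), blockWeight, if_pos (hrun J hJ (by omega))]
      push_cast
      ring
  rcases le_total J q with h | h
  · rw [hF J hpJ h]
    have : (p : ℝ) ≤ J := by exact_mod_cast hpJ
    nlinarith
  · rw [hR J h hJs, hF q hpq le_rfl]
    have : (J : ℝ) ≤ s := by exact_mod_cast hJs
    linarith

lemma sum_blockWeight_nonpos (hab : ∀ k, a k < b k) (hba : ∀ k, b k ≤ a (k + 1)) (hw : 0 ≤ w)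
    (hcost0 : (b 0 : ℝ) - a 0 ≤ w * a 0)
    (hcost : ∀ k, (b (k + 1) : ℝ) - a (k + 1) ≤ w * (a (k + 1) - b k)) (J : ℕ) :
    ∑ j ∈ Finset.range J, blockWeight w a b j ≤ 0 := by
  have key : ∀ k J, J ≤ b k → ∑ j ∈ Finset.range J, blockWeight w a b j ≤ 0 := by
    intro k
    induction k with
    | zero =>
      intro J hJ
      exact sum_blockWeight_nonpos_step hw (Nat.zero_le (a 0)) (by simp)
        (fun j _ h => not_inRun_of_lt hab hba h) (fun j h h' => ⟨0, h, h'⟩)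
        (by simpa using hcost0) (Nat.zero_le J) hJ
    | succ k ih =>
      intro J hJ
      rcases le_total J (b k) with h | h
      · exact ih J h
      · exact sum_blockWeight_nonpos_step hw (hba k) (ih _ le_rfl)
          (fun j h h' => not_inRun_between hab hba h h') (fun j h h' => ⟨k + 1, h, h'⟩)
          (hcost k) h hJ
  exact key J J (strictMono_right hab hba).le_apply

end Cost

/-- A real sequence growing by the factor `θ⁻¹` in the limit, which may be infinite. -/
lemma exists_growing_sequence {θ δ B₀ : ℝ} (hθ : 0 ≤ θ) (hδ : 0 < δ) (hθδ : θ + δ < 1)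
    (hB : 0 < B₀) :
    ∃ B ρ : ℕ → ℝ, (∀ k, B₀ ≤ B k) ∧ Monotone B ∧ Tendsto B atTop atTop ∧
      (∀ k, B k = ρ k * B (k + 1)) ∧ (∀ k, ρ k ≤ θ + δ) ∧ Tendsto ρ atTop (nhds θ) := by
  obtain ⟨k₀, hk₀⟩ := exists_nat_one_div_lt hδ
  let ρ : ℕ → ℝ := fun k => θ + 1 / ((k + k₀ : ℕ) + 1)
  have hρ0 : ∀ k, 0 < ρ k := fun k => by positivity
  have hρδ : ∀ k, ρ k ≤ θ + δ := fun k => by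
    have : 1 / (((k + k₀ : ℕ) : ℝ) + 1) ≤ 1 / ((k₀ : ℝ) + 1) :=
      one_div_le_one_div_of_le (by positivity) (by push_cast; linarith [Nat.cast_nonneg (α := ℝ) k])
    simp only [ρ]
    linarith
  let B : ℕ → ℝ := fun k => B₀ * ∏ j ∈ Finset.range k, (ρ j)⁻¹
  have hstep : ∀ k, B k = ρ k * B (k + 1) := fun k => by
    have := (hρ0 k).ne'
    simp only [B, Finset.prod_range_succ]
    field_simp
  have hθδ0 : 0 < θ + δ := by linarith
  have hgeo : ∀ k, B₀ * ((θ + δ)⁻¹) ^ k ≤ B k := fun k => by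
    refine mul_le_mul_of_nonneg_left ?_ hB.le
    calc ((θ + δ)⁻¹) ^ k = ∏ j ∈ Finset.range k, (θ + δ)⁻¹ := by simp
      _ ≤ _ := Finset.prod_le_prod (fun _ _ => (inv_pos.2 hθδ0).le)
        fun j _ => inv_anti₀ (hρ0 j) (hρδ j)
  have hone : 1 < (θ + δ)⁻¹ := (one_lt_inv₀ hθδ0).2 hθδ
  have hBB : ∀ k, B₀ ≤ B k := fun k =>
    (le_mul_of_one_le_right hB.le (one_le_pow₀ hone.le)).trans (hgeo k)
  refine ⟨B, ρ, hBB, monotone_nat_of_le_succ fun k => ?_, ?_, hstep, hρδ, ?_⟩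
  · rw [hstep k]
    exact mul_le_of_le_one_left (hB.le.trans (hBB _)) ((hρδ k).trans hθδ.le)
  · exact tendsto_atTop_mono hgeo ((tendsto_pow_atTop_atTop_of_one_lt hone).const_mul_atTop hB)
  · have h := (tendsto_one_div_add_atTop_nhds_zero_nat (𝕜 := ℝ)).comp (tendsto_add_atTop_nat k₀)
    have := h.const_add θ
    rw [add_zero] at this
    exact this

lemma exists_blocks {θ β w : ℝ} (hθ : 0 ≤ θ) (hβ : 0 < β) (hθβ : θ + β < 1)
    (hw : β < w * (1 - β - θ)) :
    ∃ a b : ℕ → ℕ, (∀ k, a k < b k) ∧ (∀ k, b k ≤ a (k + 1)) ∧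
      (Monotone fun k => b k - a k) ∧
      Tendsto (fun k => ((b k - a k : ℕ) : ℝ) / b k) atTop (nhds β) ∧
      Tendsto (fun k => ((b k - a k : ℕ) : ℝ) / (a (k + 1) + (b k - a k) : ℕ))
        atTop (nhds (β * θ / (1 - β + β * θ))) ∧
      (b 0 : ℝ) - a 0 ≤ w * a 0 ∧
      ∀ k, (b (k + 1) : ℝ) - a (k + 1) ≤ w * (a (k + 1) - b k) := by
  have hw0 : 0 < w := by
    by_contra h
    have : w * (1 - β - θ) ≤ 0 := mul_nonpos_of_nonpos_of_nonneg (not_lt.1 h) (by linarith)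
    linarith
  obtain ⟨δ, hδ, hδ1, hδ2⟩ : ∃ δ : ℝ, 0 < δ ∧ θ + δ < 1 - β ∧ β ≤ w * (1 - β - θ - 2 * δ) := by
    refine ⟨min ((1 - β - θ) / 2) ((w * (1 - β - θ) - β) / (2 * w)), ?_, ?_, ?_⟩
    · exact lt_min (by linarith) (div_pos (by linarith) (by linarith))
    · have := min_le_left ((1 - β - θ) / 2) ((w * (1 - β - θ) - β) / (2 * w))
      linarith
    · have := min_le_right ((1 - β - θ) / 2) ((w * (1 - β - θ) - β) / (2 * w))
      rw [le_div_iff₀ (by linarith)] at this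
      linarith
  obtain ⟨B, ρ, hB0, hBm, hBt, hBs, hρ, hρt⟩ := exists_growing_sequence (B₀ := 1 / β + 1 / δ)
    hθ hδ (by linarith) (by positivity)
  have hBpos : ∀ k, 0 < B k := fun k => lt_of_lt_of_le (by positivity) (hB0 k)
  have hβB : ∀ k, 1 ≤ β * B k := fun k => by
    have h1 : 1 / β ≤ B k := le_trans (le_add_of_nonneg_right (by positivity)) (hB0 k)
    rw [div_le_iff₀ hβ] at h1
    linarith
  have hδB : ∀ k, 1 ≤ δ * B k := fun k => by
    have h1 : 1 / δ ≤ B k := le_trans (le_add_of_nonneg_left (by positivity)) (hB0 k)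
    rw [div_le_iff₀ hδ] at h1
    linarith
  let c : ℕ → ℕ := fun k => ⌊β * B k⌋₊
  let a : ℕ → ℕ := fun k => ⌊(1 - β) * B k⌋₊
  have hc : ∀ k, (c k : ℝ) ≤ β * B k := fun k =>
    Nat.floor_le (mul_nonneg hβ.le (hBpos k).le)
  have ha : ∀ k, (a k : ℝ) ≤ (1 - β) * B k := fun k =>
    Nat.floor_le (mul_nonneg (by linarith) (hBpos k).le)
  have ha' : ∀ k, (1 - β) * B k - 1 < a k := fun k => Nat.sub_one_lt_floor _
  have hcsub : ∀ k, a k + c k - a k = c k := fun k => Nat.add_sub_cancel_left _ _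
  have hct : Tendsto (fun k => (c k : ℝ) / B k) atTop (nhds β) :=
    (tendsto_nat_floor_mul_div_atTop hβ.le).comp hBt
  have hat : Tendsto (fun k => (a k : ℝ) / B k) atTop (nhds (1 - β)) :=
    (tendsto_nat_floor_mul_div_atTop (by linarith)).comp hBt
  refine ⟨a, fun k => a k + c k, fun k => ?_, fun k => ?_, ?_, ?_, ?_, ?_, fun k => ?_⟩
  · exact Nat.lt_add_of_pos_right (Nat.floor_pos.2 (hβB k))
  · refine Nat.le_floor ?_
    push_cast
    have h1 := mul_le_mul_of_nonneg_right ((hρ k).trans hδ1.le) (hBpos (k + 1)).le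
    rw [← hBs] at h1
    linarith [ha k, hc k]
  · simp only [hcsub]
    exact fun i j hij => Nat.floor_mono (mul_le_mul_of_nonneg_left (hBm hij) hβ.le)
  · simp only [hcsub]
    have h := hct.div (hat.add hct) (by rw [sub_add_cancel]; exact one_ne_zero)
    rw [sub_add_cancel, div_one] at h
    refine h.congr fun k => ?_
    have := (hBpos k).ne'
    simp only [Pi.div_apply]
    rw [← add_div, div_div_div_cancel_right₀ this]
    push_cast
    rfl
  · simp only [hcsub]
    have h1 : Tendsto (fun k => (c k : ℝ) / B (k + 1)) atTop (nhds (β * θ)) := by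
      refine (hct.mul hρt).congr fun k => ?_
      have h2 := (hBpos k).ne'
      have h3 := (hBpos (k + 1)).ne'
      rw [div_mul_eq_mul_div, div_eq_div_iff h2 h3, hBs k]
      ring
    have h2 := (hat.comp (tendsto_add_atTop_nat 1)).add h1
    have h3 : 1 - β + β * θ ≠ 0 := by
      have := mul_nonneg hβ.le hθ
      exact ne_of_gt (by linarith)
    refine (h1.div h2 h3).congr fun k => ?_
    have := (hBpos (k + 1)).ne'
    simp only [Pi.div_apply, Function.comp]
    rw [← add_div, div_div_div_cancel_right₀ this]
    push_cast
    rfl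
  · have h1 := mul_le_mul_of_nonneg_right hδ2 (hBpos 0).le
    have h2 : B 0 * (1 - β - θ - 2 * δ) ≤ a 0 := by
      have := ha' 0
      have := hδB 0
      have := mul_nonneg hθ (hBpos 0).le
      nlinarith [hBpos 0]
    have h3 := mul_le_mul_of_nonneg_left h2 hw0.le
    have := hc 0
    push_cast
    linarith
  · have h1 := mul_le_mul_of_nonneg_right hδ2 (hBpos (k + 1)).le
    have h2 : B (k + 1) * (1 - β - θ - 2 * δ) ≤ a (k + 1) - (a k + c k) := by
      have h4 := ha' (k + 1)
      have h5 := hδB (k + 1)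
      have h6 := ha k
      have h7 := hc k
      have h8 := mul_le_mul_of_nonneg_right (hρ k) (hBpos (k + 1)).le
      rw [← hBs] at h8
      nlinarith
    have h3 := mul_le_mul_of_nonneg_left h2 hw0.le
    have := hc (k + 1)
    push_cast
    linarith

lemma ofReal_le_dimH_Eab {α β θ u s t : ℝ} (hα : 0 ≤ α) (hα1 : α ≤ 1) (hθ : 0 ≤ θ) (hβ : 0 < β)
    (hθβ : θ + β < 1) (hαθ : β * θ / (1 - β + β * θ) = α) (hu : u = β / (1 - β - θ))
    (hs : lurothF u s = 1) (ht : 0 < t) (hts : t < s) : ENNReal.ofReal t ≤ dimH (Eab α β) := by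
  have hden : 0 < 1 - β - θ := by linarith
  have hu0 : 0 < u := hu ▸ div_pos hβ hden
  set s' := (t + s) / 2 with hs'
  set u' := s' * u / t with hu'
  have huu' : u < u' := by
    rw [hu', lt_div_iff₀ ht, mul_comm]
    exact mul_lt_mul_of_pos_right (by linarith) hu0
  set w := (u + u') / 2 with hw
  have hw' : β < w * (1 - β - θ) := by
    rw [← div_lt_iff₀ hden, ← hu]
    linarith
  obtain ⟨a, b, hab, hba, hmono, hlβ, hlα, hc0, hc⟩ := exists_blocks hθ hβ hθβ hw'
  rw [hαθ] at hlα
  have huw : 0 < u' - w := by linarith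
  obtain ⟨L₀, hL₀⟩ := exists_nat_ge ((2 * w + 2 * u' + 4) / (u' - w))
  set L := max L₀ 3
  have hL : 3 ≤ L := le_max_right _ _
  have hLw : w * (L + 2) ≤ u' * (L - 2) - 4 := by
    have h1 : (2 * w + 2 * u' + 4) / (u' - w) ≤ L :=
      hL₀.trans (by exact_mod_cast le_max_left L₀ 3)
    rw [div_le_iff₀ huw] at h1
    linarith
  have hblock := sum_blockWeight_nonpos hab hba (w := w) (by linarith) hc0 hc
  refine (le_dimH_prescribedSet_of_lurothF (s' := s') hu0.le hs ht (by linarith) (by linarith)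
    (le_of_eq (by rw [hu']; field_simp)) (blockPattern_eq_two_or_three (L := L) (a := a) (b := b))
    (sum_digitWeight_le hL (by linarith) hLw hblock)).trans (dimH_mono ?_)
  rintro x ⟨d, hd2, hd, rfl⟩
  exact ⟨⟨lurothPoint_pos hd2, lurothPoint_le_one hd2⟩,
    runLen_asymptotics hab hba hL hmono hd (lurothD_lurothPoint hd2) hα hα1 hβ.le hlβ hlα⟩

/-- Lower bound: if 0 ≤ α < β/(1+β) < β < 1, then
    dimH E(α,β) ≥ s(β²(1-α)/((1-β)(β-α(1+β)))). -/
theorem luroth_Eαβ_dimH_lower (S : ℝ → ℝ)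
    (hS : ∀ u : ℝ, 0 ≤ u → 1/2 < S u ∧ lurothF u (S u) = 1)
    (α β : ℝ) (hα0 : 0 ≤ α) (h1 : α < β / (1 + β)) (h2 : β / (1 + β) < β) (hβ1 : β < 1) :
    ENNReal.ofReal (S (β ^ 2 * (1 - α) / ((1 - β) * (β - α * (1 + β))))) ≤
      dimH (Eab α β) := by
  have hβ0 : 0 < β := by
    by_contra h
    rcases lt_or_ge (1 + β) 0 with h' | h'
    · have : 1 ≤ β / (1 + β) := by rw [le_div_iff_of_neg h']; linarith
      linarith
    · have := div_nonpos_of_nonpos_of_nonneg (not_lt.1 h) h'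
      linarith
  have hαβ : α * (1 + β) < β := by rwa [lt_div_iff₀ (by linarith)] at h1
  have hα1 : α < 1 := by nlinarith
  have hαb : 0 < β - α * (1 + β) := by linarith
  have h1α : 0 < 1 - α := by linarith
  have h1β : 0 < 1 - β := by linarith
  set θ := α * (1 - β) / (β * (1 - α)) with hθ
  have hθ0 : 0 ≤ θ := by positivity
  have hsub : 1 - β - θ = (1 - β) * (β - α * (1 + β)) / (β * (1 - α)) := by
    rw [hθ]
    field_simp
    ring
  have hpos : 0 < 1 - β - θ := by
    rw [hsub]
    positivity
  set u := β ^ 2 * (1 - α) / ((1 - β) * (β - α * (1 + β))) with hu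
  have hu0 : 0 ≤ u := by positivity
  have hu' : u = β / (1 - β - θ) := by
    rw [hsub, hu]
    field_simp
  have hαθ : β * θ / (1 - β + β * θ) = α := by
    have e : 1 - β + β * θ = (1 - β) / (1 - α) := by
      rw [hθ]
      field_simp
      ring
    rw [e, hθ]
    field_simp
  obtain ⟨hs1, hs2⟩ := hS u hu0
  refine le_of_forall_lt fun c hc => ?_
  obtain ⟨t, hct, ht⟩ := exists_between hc
  have htop : t ≠ ⊤ := (ht.trans ENNReal.ofReal_lt_top).ne
  have ht0 : 0 < t.toReal := ENNReal.toReal_pos (hct.trans_le' bot_le).ne' htop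
  have hts : t.toReal < S u := (ENNReal.lt_ofReal_iff_toReal_lt htop).1 ht
  have h := ofReal_le_dimH_Eab hα0 hα1.le hθ0 hβ0 (by linarith) hαθ hu' hs2 ht0 hts
  rw [ENNReal.ofReal_toReal htop] at h
  exact hct.trans_le h
end

section
/- For Lebesgue-almost every x ∈ (0,1], lim_{n→∞} ℓ_n(x)/log₂ n = 1. -/
open Filter MeasureTheory Set

/-- The Lebesgue measure of the set where the first Lüroth digit is `t + 2`. -/
noncomputable def lurothWeight (t : ℕ) : ℝ := 1 / (((t : ℝ) + 1) * ((t : ℝ) + 2))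

/-- The points whose first `k` Lüroth digits all coincide. -/
def lurothConstBlock (k : ℕ) : Set ℝ :=
  {x | ∀ i < k, lurothD (i + 1) x = lurothD 1 x}

/-- The points whose first `k` Lüroth digits all equal `a`. -/
def lurothBlock (a k : ℕ) : Set ℝ :=
  {x | ∀ i < k, lurothD (i + 1) x = a}

lemma lurothWeight_nonneg (t : ℕ) : 0 ≤ lurothWeight t := by
  unfold lurothWeight; positivity

lemma lurothWeight_zero : lurothWeight 0 = 1 / 2 := by
  norm_num [lurothWeight]

lemma lurothWeight_le_half (t : ℕ) : lurothWeight t ≤ 1 / 2 := by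
  unfold lurothWeight
  apply one_div_le_one_div_of_le (by norm_num)
  have : (0 : ℝ) ≤ t := t.cast_nonneg
  nlinarith

lemma sum_lurothWeight (a n : ℕ) :
    ∑ t ∈ Finset.range n, lurothWeight (t + a) = 1 / ((a : ℝ) + 1) - 1 / ((a : ℝ) + n + 1) := by
  induction n with
  | zero => simp
  | succ n ih =>
    rw [Finset.sum_range_succ, ih, lurothWeight]
    push_cast
    have h1 : (a : ℝ) + n + 1 ≠ 0 := by positivity
    have h2 : (a : ℝ) + n + 2 ≠ 0 := by positivity
    have h3 : (n : ℝ) + a + 1 ≠ 0 := by positivity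
    have h4 : (n : ℝ) + a + 2 ≠ 0 := by positivity
    have h5 : (a : ℝ) + (n + 1) + 1 ≠ 0 := by positivity
    have h6 : (a : ℝ) + 1 ≠ 0 := by positivity
    field_simp
    ring

lemma tsum_lurothWeight_le (a : ℕ) :
    ∑' t : ℕ, ENNReal.ofReal (lurothWeight (t + a)) ≤ ENNReal.ofReal (1 / ((a : ℝ) + 1)) := by
  refine ENNReal.tsum_le_of_sum_range_le fun n => ?_
  rw [← ENNReal.ofReal_sum_of_nonneg fun t _ => lurothWeight_nonneg _, sum_lurothWeight]
  apply ENNReal.ofReal_le_ofReal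
  have : (0 : ℝ) ≤ 1 / ((a : ℝ) + n + 1) := by positivity
  linarith

lemma tsum_lurothWeight_mul_le (c : ENNReal) :
    ∑' t : ℕ, ENNReal.ofReal (lurothWeight t) * c ≤ c := by
  rw [ENNReal.tsum_mul_right]
  calc _ ≤ 1 * c := by
        gcongr
        simpa using tsum_lurothWeight_le 0
    _ = c := one_mul c

lemma lurothD_add_one (j : ℕ) (x : ℝ) : lurothD (j + 1) x = lurothD 1 (lurothT^[j] x) := by
  simp [lurothD]

lemma lurothD_iterate (j i : ℕ) (x : ℝ) :
    lurothD (i + 1) (lurothT^[j] x) = lurothD (j + i + 1) x := by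
  rw [lurothD_add_one, lurothD_add_one (j + i), ← Function.iterate_add_apply, add_comm i j]

lemma floor_one_div_eq_iff {x : ℝ} (hx : 0 < x) (t : ℕ) :
    ⌊1 / x⌋ = (t : ℤ) + 1 ↔ ((t : ℝ) + 1) * x ≤ 1 ∧ 1 < ((t : ℝ) + 2) * x := by
  rw [Int.floor_eq_iff, le_div_iff₀ hx, div_lt_iff₀ hx]
  push_cast
  ring_nf

lemma lurothD_one_eq_iff {x : ℝ} (hx : 0 < x) (t : ℕ) :
    lurothD 1 x = t + 2 ↔ ((t : ℝ) + 1) * x ≤ 1 ∧ 1 < ((t : ℝ) + 2) * x := by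
  rw [← floor_one_div_eq_iff hx]
  simp only [lurothD, Nat.sub_self, Function.iterate_zero, id]
  omega

lemma lurothT_eq {x : ℝ} (hx : 0 < x) {t : ℕ} (h : lurothD 1 x = t + 2) :
    lurothT x = ((t : ℝ) + 1) * (((t : ℝ) + 2) * x - 1) := by
  have h' := (floor_one_div_eq_iff hx t).2 ((lurothD_one_eq_iff hx t).1 h)
  rw [lurothT, h']
  have h2 : (t : ℝ) + 1 + 1 ≠ 0 := by positivity
  push_cast
  field_simp
  ring

lemma exists_lurothD_one_eq {x : ℝ} (hx : x ∈ Ioc (0 : ℝ) 1) : ∃ t : ℕ, lurothD 1 x = t + 2 := by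
  have h : (1 : ℤ) ≤ ⌊1 / x⌋ := by
    rw [Int.le_floor, le_div_iff₀ hx.1]
    simpa using hx.2
  refine ⟨(⌊1 / x⌋ - 1).toNat, ?_⟩
  simp only [lurothD, Nat.sub_self, Function.iterate_zero, id]
  omega

lemma lurothT_mem {x : ℝ} (hx : x ∈ Ioc (0 : ℝ) 1) : lurothT x ∈ Ioc (0 : ℝ) 1 := by
  obtain ⟨t, ht⟩ := exists_lurothD_one_eq hx
  rw [lurothT_eq hx.1 ht]
  obtain ⟨h1, h2⟩ := (lurothD_one_eq_iff hx.1 t).1 ht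
  have h3 : (0 : ℝ) ≤ t := t.cast_nonneg
  constructor
  · have : 0 < ((t : ℝ) + 2) * x - 1 := by linarith
    positivity
  · nlinarith

lemma volume_lurothD_one_eq_inter_preimage (t : ℕ) (S : Set ℝ) :
    volume {x | x ∈ Ioc (0 : ℝ) 1 ∧ lurothD 1 x = t + 2 ∧ lurothT x ∈ S} ≤
      ENNReal.ofReal (lurothWeight t) * volume (Ioc (0 : ℝ) 1 ∩ S) := by
  have hsub : {x | x ∈ Ioc (0 : ℝ) 1 ∧ lurothD 1 x = t + 2 ∧ lurothT x ∈ S} ⊆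
      (fun x => (((t : ℝ) + 1) * ((t : ℝ) + 2)) * x) ⁻¹'
        ((fun y => y + (-((t : ℝ) + 1))) ⁻¹' (Ioc (0 : ℝ) 1 ∩ S)) := by
    rintro x ⟨hx, hd, hS⟩
    have hT := lurothT_mem hx
    rw [lurothT_eq hx.1 hd] at hT hS
    have e : ((t : ℝ) + 1) * ((t : ℝ) + 2) * x + (-((t : ℝ) + 1)) =
        ((t : ℝ) + 1) * (((t : ℝ) + 2) * x - 1) := by ring
    simp only [mem_preimage, e]
    exact ⟨hT, hS⟩
  refine (measure_mono hsub).trans ?_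
  have hpos : (0 : ℝ) < ((t : ℝ) + 1) * ((t : ℝ) + 2) := by positivity
  rw [Real.volume_preimage_mul_left hpos.ne', measure_preimage_add_right,
    abs_of_pos (inv_pos.2 hpos), lurothWeight, one_div]

lemma volume_le_tsum_lurothD_one {A : Set ℝ} (hA : A ⊆ Ioc 0 1) :
    volume A ≤ ∑' t : ℕ, volume {x | x ∈ A ∧ lurothD 1 x = t + 2} := by
  refine (measure_mono fun x hx => ?_).trans (measure_iUnion_le _)
  obtain ⟨t, ht⟩ := exists_lurothD_one_eq (hA hx)
  exact mem_iUnion.2 ⟨t, hx, ht⟩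

lemma volume_iterate_preimage_le (j : ℕ) (S : Set ℝ) :
    volume (Ioc (0 : ℝ) 1 ∩ lurothT^[j] ⁻¹' S) ≤ volume (Ioc (0 : ℝ) 1 ∩ S) := by
  induction j with
  | zero => simp
  | succ j ih =>
    refine (volume_le_tsum_lurothD_one inter_subset_left).trans ?_
    refine le_trans (ENNReal.tsum_le_tsum fun t => ?_) (tsum_lurothWeight_mul_le _)
    refine le_trans ?_ ((volume_lurothD_one_eq_inter_preimage t (lurothT^[j] ⁻¹' S)).trans
      (by gcongr))
    apply measure_mono
    rintro x ⟨⟨hx, hS⟩, hd⟩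
    exact ⟨hx, hd, by simpa [Function.iterate_succ_apply] using hS⟩

lemma mem_lurothBlock_succ {a k : ℕ} {x : ℝ} :
    x ∈ lurothBlock a (k + 1) ↔ lurothD 1 x = a ∧ lurothT x ∈ lurothBlock a k := by
  have h (i : ℕ) : lurothD (i + 1) (lurothT x) = lurothD (i + 1 + 1) x := by
    simpa [add_comm, add_left_comm] using lurothD_iterate 1 i x
  simp only [lurothBlock, mem_ofPred_eq, h, Nat.forall_lt_succ_left, zero_add]

lemma volume_lurothBlock_le (t k : ℕ) :
    volume (Ioc (0 : ℝ) 1 ∩ lurothBlock (t + 2) k) ≤ ENNReal.ofReal (lurothWeight t ^ k) := by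
  induction k with
  | zero => simpa using measure_mono (μ := volume) (inter_subset_left : Ioc (0 : ℝ) 1 ∩ _ ⊆ _)
  | succ k ih =>
    rw [pow_succ', ENNReal.ofReal_mul (lurothWeight_nonneg t)]
    refine le_trans (measure_mono ?_)
      ((volume_lurothD_one_eq_inter_preimage t (lurothBlock (t + 2) k)).trans (by gcongr))
    rintro x ⟨hx, hb⟩
    exact ⟨hx, mem_lurothBlock_succ.1 hb⟩

lemma volume_lurothConstBlock_le (k : ℕ) :
    volume (Ioc (0 : ℝ) 1 ∩ lurothConstBlock (k + 1)) ≤ ENNReal.ofReal ((1 / 2) ^ k) := by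
  refine (volume_le_tsum_lurothD_one inter_subset_left).trans ?_
  refine le_trans (ENNReal.tsum_le_tsum fun t => ?_) (tsum_lurothWeight_mul_le _)
  calc volume {x | x ∈ Ioc (0 : ℝ) 1 ∩ lurothConstBlock (k + 1) ∧ lurothD 1 x = t + 2}
      ≤ volume (Ioc (0 : ℝ) 1 ∩ lurothBlock (t + 2) (k + 1)) := by
        apply measure_mono
        rintro x ⟨⟨hx, hb⟩, hd⟩
        exact ⟨hx, fun i hi => (hb i hi).trans hd⟩
    _ ≤ ENNReal.ofReal (lurothWeight t ^ (k + 1)) := volume_lurothBlock_le _ _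
    _ ≤ ENNReal.ofReal (lurothWeight t) * ENNReal.ofReal ((1 / 2) ^ k) := by
        rw [pow_succ', ENNReal.ofReal_mul (lurothWeight_nonneg t)]
        gcongr
        · exact lurothWeight_nonneg t
        · exact lurothWeight_le_half t

lemma volume_compl_lurothBlock_inter_le (k : ℕ) (S : Set ℝ) :
    volume (Ioc (0 : ℝ) 1 ∩ ((lurothBlock 2 k)ᶜ ∩ lurothT^[k] ⁻¹' S)) ≤
      ENNReal.ofReal (1 - (1 / 2) ^ k) * volume (Ioc (0 : ℝ) 1 ∩ S) := by
  induction k with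
  | zero => simp [lurothBlock]
  | succ k ih =>
    refine (volume_le_tsum_lurothD_one inter_subset_left).trans ?_
    rw [tsum_eq_zero_add' ENNReal.summable]
    have hpow : ((1 : ℝ) / 2) ^ k ≤ 1 := pow_le_one₀ (by norm_num) (by norm_num)
    have h0 : volume {x | x ∈ Ioc (0 : ℝ) 1 ∩ ((lurothBlock 2 (k + 1))ᶜ ∩
        lurothT^[k + 1] ⁻¹' S) ∧ lurothD 1 x = 0 + 2} ≤
        ENNReal.ofReal (1 / 2) *
          (ENNReal.ofReal (1 - (1 / 2) ^ k) * volume (Ioc (0 : ℝ) 1 ∩ S)) := by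
      refine le_trans (measure_mono ?_) ((volume_lurothD_one_eq_inter_preimage 0
        ((lurothBlock 2 k)ᶜ ∩ lurothT^[k] ⁻¹' S)).trans
          (by rw [lurothWeight_zero]; exact mul_le_mul' le_rfl ih))
      rintro x ⟨⟨hx, hb, hS⟩, hd⟩
      exact ⟨hx, hd, fun h => hb (mem_lurothBlock_succ.2 ⟨hd, h⟩),
        by simpa [Function.iterate_succ_apply] using hS⟩
    have h1 (t : ℕ) : volume {x | x ∈ Ioc (0 : ℝ) 1 ∩ ((lurothBlock 2 (k + 1))ᶜ ∩
        lurothT^[k + 1] ⁻¹' S) ∧ lurothD 1 x = (t + 1) + 2} ≤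
        ENNReal.ofReal (lurothWeight (t + 1)) * volume (Ioc (0 : ℝ) 1 ∩ S) := by
      refine le_trans (measure_mono ?_) ((volume_lurothD_one_eq_inter_preimage (t + 1)
        (lurothT^[k] ⁻¹' S)).trans
          (mul_le_mul' le_rfl (volume_iterate_preimage_le k S)))
      rintro x ⟨⟨hx, -, hS⟩, hd⟩
      exact ⟨hx, hd, by simpa [Function.iterate_succ_apply] using hS⟩
    refine (add_le_add h0 (ENNReal.tsum_le_tsum h1)).trans ?_
    rw [ENNReal.tsum_mul_right, ← mul_assoc, ← add_mul]
    gcongr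
    refine (add_le_add le_rfl (tsum_lurothWeight_le 1)).trans ?_
    rw [← ENNReal.ofReal_mul (by norm_num), ← ENNReal.ofReal_add (by nlinarith) (by norm_num)]
    apply ENNReal.ofReal_le_ofReal
    rw [pow_succ]
    norm_num
    linarith

lemma volume_forall_notMem_lurothBlock_le (k m : ℕ) :
    volume (Ioc (0 : ℝ) 1 ∩ {x | ∀ b < m, lurothT^[b * k] x ∉ lurothBlock 2 k}) ≤
      ENNReal.ofReal ((1 - (1 / 2) ^ k) ^ m) := by
  have hpow : ((1 : ℝ) / 2) ^ k ≤ 1 := pow_le_one₀ (by norm_num) (by norm_num)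
  induction m with
  | zero => simp
  | succ m ih =>
    rw [pow_succ', ENNReal.ofReal_mul (by linarith)]
    refine le_trans (measure_mono ?_) ((volume_compl_lurothBlock_inter_le k
      {x | ∀ b < m, lurothT^[b * k] x ∉ lurothBlock 2 k}).trans (by gcongr))
    rintro x ⟨hx, hb⟩
    refine ⟨hx, by simpa using hb 0 (by omega), fun b hbm => ?_⟩
    rw [← Function.iterate_add_apply, ← Nat.succ_mul]
    exact hb (b + 1) (by omega)

lemma ae_eventually_exists_lurothBlock :
    ∀ᵐ x : ℝ, x ∈ Ioc (0 : ℝ) 1 →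
      ∀ᶠ k : ℕ in atTop, ∃ b < k * 2 ^ k, lurothT^[b * k] x ∈ lurothBlock 2 k := by
  have hle (k : ℕ) : volume (Ioc (0 : ℝ) 1 ∩
      {x | ∀ b < k * 2 ^ k, lurothT^[b * k] x ∉ lurothBlock 2 k}) ≤
      ENNReal.ofReal (Real.exp (-k)) := by
    refine (volume_forall_notMem_lurothBlock_le k _).trans (ENNReal.ofReal_le_ofReal ?_)
    have hpow : ((1 : ℝ) / 2) ^ k ≤ 1 := pow_le_one₀ (by norm_num) (by norm_num)
    calc (1 - ((1 : ℝ) / 2) ^ k) ^ (k * 2 ^ k)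
        ≤ (Real.exp (-(1 / 2) ^ k)) ^ (k * 2 ^ k) :=
          pow_le_pow_left₀ (by linarith) (Real.one_sub_le_exp_neg _) _
      _ = Real.exp (-k) := by
          rw [← Real.exp_nat_mul]
          congr 1
          push_cast
          rw [mul_neg, mul_assoc, ← mul_pow]
          norm_num
  have hsum := (ENNReal.tsum_le_tsum hle).trans_lt
    Real.summable_exp_neg_nat.tsum_ofReal_lt_top
  filter_upwards [ae_eventually_notMem hsum.ne] with x hx hxI
  filter_upwards [hx] with k hk
  by_contra! h
  exact hk ⟨hxI, h⟩

lemma ae_eventually_notMem_lurothConstBlock :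
    ∀ᵐ x : ℝ, x ∈ Ioc (0 : ℝ) 1 →
      ∀ᶠ k : ℕ in atTop, ∀ j < 2 ^ k / k ^ 2, lurothT^[j] x ∉ lurothConstBlock (k + 1) := by
  have hle (k : ℕ) : volume (⋃ j ∈ Finset.range (2 ^ k / k ^ 2),
      Ioc (0 : ℝ) 1 ∩ lurothT^[j] ⁻¹' lurothConstBlock (k + 1)) ≤
      ENNReal.ofReal (1 / (k : ℝ) ^ 2) := by
    refine (measure_biUnion_finset_le _ _).trans ((Finset.sum_le_sum fun j _ =>
      (volume_iterate_preimage_le j _).trans (volume_lurothConstBlock_le k)).trans ?_)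
    rw [Finset.sum_const, Finset.card_range, nsmul_eq_mul, ← ENNReal.ofReal_natCast,
      ← ENNReal.ofReal_mul (Nat.cast_nonneg _)]
    apply ENNReal.ofReal_le_ofReal
    calc ((2 ^ k / k ^ 2 : ℕ) : ℝ) * (1 / 2) ^ k
        ≤ ((2 ^ k : ℕ) : ℝ) / ((k ^ 2 : ℕ) : ℝ) * (1 / 2) ^ k := by
          gcongr
          exact Nat.cast_div_le
      _ = 1 / (k : ℝ) ^ 2 := by
          push_cast
          rw [div_mul_eq_mul_div, ← mul_pow]
          norm_num
  have hsum := (ENNReal.tsum_le_tsum hle).trans_lt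
    (Real.summable_one_div_nat_pow.2 one_lt_two).tsum_ofReal_lt_top
  filter_upwards [ae_eventually_notMem hsum.ne] with x hx hxI
  filter_upwards [hx] with k hk j hj hmem
  exact hk (mem_biUnion (Finset.mem_coe.2 (Finset.mem_range.2 hj)) ⟨hxI, hmem⟩)

lemma le_runLen_s9 {n j k : ℕ} {x : ℝ} (hk : 1 ≤ k) (hn : j + k ≤ n)
    (h : lurothT^[j] x ∈ lurothBlock 2 k) : k ≤ runLen n x := by
  have h' (i : ℕ) (h1 : 1 ≤ i) (hi : i ≤ k) : lurothD (j + i) x = 2 := by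
    obtain ⟨i, rfl⟩ := Nat.exists_eq_add_of_le' h1
    simpa [lurothD_iterate, add_assoc] using h i (by omega)
  refine le_csSup ⟨n, fun m hm => ?_⟩ ⟨hk, j, hn, fun i h1 hi => ?_⟩
  · obtain ⟨-, j, hj, -⟩ := hm
    omega
  · rw [h' i h1 hi, h' 1 le_rfl hk]

lemma runLen_le_s9 {n k : ℕ} {x : ℝ}
    (h : ∀ j < n, lurothT^[j] x ∉ lurothConstBlock (k + 1)) : runLen n x ≤ k := by
  refine csSup_le' ?_
  rintro m ⟨hm, j, hj, hrun⟩
  by_contra! hlt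
  refine h j (by omega) fun i hi => ?_
  rw [lurothD_iterate, add_assoc, hrun (i + 1) (by omega) (by omega)]
  exact lurothD_add_one j x

lemma eventually_sq_le_two_rpow {ε c : ℝ} (hε : 0 < ε) (hc : 0 ≤ c) :
    ∀ᶠ L : ℝ in atTop, (c * L + 1) ^ 2 ≤ (2 : ℝ) ^ (ε * L) := by
  have hb : 0 < Real.log 2 * ε := mul_pos (Real.log_pos one_lt_two) hε
  have hC : 0 < ((c + 1) ^ 2)⁻¹ := by positivity
  filter_upwards [(isLittleO_pow_exp_pos_mul_atTop 2 hb).bound hC, eventually_ge_atTop 1]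
    with L hL h1
  rw [Real.norm_of_nonneg (by positivity), Real.norm_of_nonneg (by positivity),
    inv_mul_eq_div, le_div_iff₀ (by positivity)] at hL
  rw [Real.rpow_def_of_pos two_pos, ← mul_assoc]
  calc (c * L + 1) ^ 2 ≤ ((c + 1) * L) ^ 2 := by
        gcongr
        linarith
    _ = L ^ 2 * (c + 1) ^ 2 := by ring
    _ ≤ _ := hL

lemma tendsto_logb_two_natCast : Tendsto (fun n : ℕ => Real.logb 2 n) atTop atTop :=
  (Real.tendsto_logb_atTop one_lt_two).comp tendsto_natCast_atTop_atTop

lemma eventually_le_logb {u : ℕ → ℕ}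
    (hu : ∀ᶠ k : ℕ in atTop, ∀ n ≤ 2 ^ k / k ^ 2, u n ≤ k) {ε : ℝ} (hε : 0 < ε) :
    ∀ᶠ n : ℕ in atTop, (u n : ℝ) ≤ (1 + ε) * Real.logb 2 n + 1 := by
  have hk : Tendsto (fun n : ℕ => ⌈(1 + ε) * Real.logb 2 n⌉₊) atTop atTop :=
    tendsto_nat_ceil_atTop.comp (tendsto_logb_two_natCast.const_mul_atTop (by linarith))
  filter_upwards [hk.eventually hu, hk.eventually_ge_atTop 1, eventually_ge_atTop 1,
    tendsto_logb_two_natCast.eventually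
      (eventually_sq_le_two_rpow hε (by linarith : 0 ≤ 1 + ε)),
    tendsto_logb_two_natCast.eventually_ge_atTop 0] with n hn hk1 hn1 hsq hL
  have hlt : (⌈(1 + ε) * Real.logb 2 n⌉₊ : ℝ) < (1 + ε) * Real.logb 2 n + 1 :=
    Nat.ceil_lt_add_one (by positivity)
  refine le_trans (Nat.cast_le.2 (hn n ?_)) hlt.le
  rw [Nat.le_div_iff_mul_le (by positivity)]
  have hn0 : (0 : ℝ) < n := by exact_mod_cast hn1
  have hle : (n : ℝ) * (⌈(1 + ε) * Real.logb 2 n⌉₊ : ℝ) ^ 2 ≤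
      (2 : ℝ) ^ ⌈(1 + ε) * Real.logb 2 n⌉₊ :=
    calc (n : ℝ) * (⌈(1 + ε) * Real.logb 2 n⌉₊ : ℝ) ^ 2
        ≤ n * (2 : ℝ) ^ (ε * Real.logb 2 n) := by
          gcongr
          exact (pow_le_pow_left₀ (Nat.cast_nonneg _) hlt.le 2).trans hsq
      _ = (2 : ℝ) ^ ((1 + ε) * Real.logb 2 n) := by
          rw [add_mul, one_mul, Real.rpow_add two_pos,
            Real.rpow_logb two_pos (by norm_num) hn0]
      _ ≤ (2 : ℝ) ^ ((⌈(1 + ε) * Real.logb 2 n⌉₊ : ℕ) : ℝ) :=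
          Real.rpow_le_rpow_of_exponent_le one_le_two (Nat.le_ceil _)
      _ = _ := Real.rpow_natCast _ _
  exact_mod_cast hle

lemma eventually_logb_le {u : ℕ → ℕ}
    (hu : ∀ᶠ k : ℕ in atTop, ∀ n ≥ k * 2 ^ k * k, k ≤ u n) {ε : ℝ} (hε : 0 < ε)
    (hε1 : ε < 1) :
    ∀ᶠ n : ℕ in atTop, (1 - ε) * Real.logb 2 n - 1 ≤ (u n : ℝ) := by
  have hk : Tendsto (fun n : ℕ => ⌊(1 - ε) * Real.logb 2 n⌋₊) atTop atTop :=
    tendsto_nat_floor_atTop.comp (tendsto_logb_two_natCast.const_mul_atTop (by linarith))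
  filter_upwards [hk.eventually hu, eventually_ge_atTop 1,
    tendsto_logb_two_natCast.eventually (eventually_sq_le_two_rpow hε zero_le_one),
    tendsto_logb_two_natCast.eventually_ge_atTop 0] with n hn hn1 hsq hL
  have hfloor : (⌊(1 - ε) * Real.logb 2 n⌋₊ : ℝ) ≤ (1 - ε) * Real.logb 2 n :=
    Nat.floor_le (mul_nonneg (by linarith) hL)
  have hlt := Nat.lt_floor_add_one ((1 - ε) * Real.logb 2 n)
  refine le_trans (by linarith) (Nat.cast_le.2 (hn n ?_))
  have hn0 : (0 : ℝ) < n := by exact_mod_cast hn1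
  have hle : (⌊(1 - ε) * Real.logb 2 n⌋₊ : ℝ) * 2 ^ ⌊(1 - ε) * Real.logb 2 n⌋₊ *
      (⌊(1 - ε) * Real.logb 2 n⌋₊ : ℝ) ≤ n :=
    calc (⌊(1 - ε) * Real.logb 2 n⌋₊ : ℝ) * 2 ^ ⌊(1 - ε) * Real.logb 2 n⌋₊ *
          (⌊(1 - ε) * Real.logb 2 n⌋₊ : ℝ)
        = (⌊(1 - ε) * Real.logb 2 n⌋₊ : ℝ) ^ 2 *
          (2 : ℝ) ^ ((⌊(1 - ε) * Real.logb 2 n⌋₊ : ℕ) : ℝ) := by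
          rw [Real.rpow_natCast]
          ring
      _ ≤ (2 : ℝ) ^ (ε * Real.logb 2 n) * (2 : ℝ) ^ ((1 - ε) * Real.logb 2 n) := by
          gcongr
          · refine (pow_le_pow_left₀ (Nat.cast_nonneg _) ?_ 2).trans hsq
            nlinarith
          · exact one_le_two
      _ = n := by
          rw [← Real.rpow_add two_pos, ← add_mul, add_sub_cancel, one_mul,
            Real.rpow_logb two_pos (by norm_num) hn0]
  exact_mod_cast hle

lemma tendsto_div_logb_two {u : ℕ → ℕ}
    (hlower : ∀ᶠ k : ℕ in atTop, ∀ n ≥ k * 2 ^ k * k, k ≤ u n)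
    (hupper : ∀ᶠ k : ℕ in atTop, ∀ n ≤ 2 ^ k / k ^ 2, u n ≤ k) :
    Tendsto (fun n : ℕ => (u n : ℝ) / Real.logb 2 n) atTop (nhds 1) := by
  refine tendsto_order.2 ⟨fun a ha => ?_, fun a ha => ?_⟩
  · have hε : 0 < min ((1 - a) / 2) (1 / 2) := lt_min (by linarith) (by norm_num)
    have hε1 : min ((1 - a) / 2) (1 / 2) < 1 := (min_le_right _ _).trans_lt (by norm_num)
    have hεa := min_le_left ((1 - a) / 2) (1 / 2)
    filter_upwards [eventually_logb_le hlower hε hε1,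
      tendsto_logb_two_natCast.eventually_gt_atTop 0,
      tendsto_logb_two_natCast.eventually_gt_atTop (2 / (1 - a))] with n hn hL hLa
    rw [div_lt_iff₀ (by linarith)] at hLa
    rw [lt_div_iff₀ hL]
    nlinarith
  · have hε : 0 < (a - 1) / 2 := by linarith
    filter_upwards [eventually_le_logb hupper hε,
      tendsto_logb_two_natCast.eventually_gt_atTop 0,
      tendsto_logb_two_natCast.eventually_gt_atTop (2 / (a - 1))] with n hn hL hLa
    rw [div_lt_iff₀ (by linarith)] at hLa
    rw [div_lt_iff₀ hL]
    nlinarith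

/-- For Lebesgue-almost every x ∈ (0,1], ℓₙ(x)/log₂ n → 1. -/
theorem luroth_runlen_log_ae :
    ∀ᵐ x : ℝ, x ∈ Set.Ioc (0:ℝ) 1 →
      Filter.Tendsto (fun n : ℕ => (runLen n x : ℝ) / Real.logb 2 n)
        Filter.atTop (nhds 1) := by
  filter_upwards [ae_eventually_exists_lurothBlock, ae_eventually_notMem_lurothConstBlock]
    with x hblock hconst hx
  refine tendsto_div_logb_two ?_ ?_
  · filter_upwards [hblock hx, eventually_ge_atTop 1] with k ⟨b, hb, hmem⟩ hk n hn
    refine le_runLen_s9 hk (le_trans ?_ hn) hmem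
    rw [← Nat.succ_mul]
    exact Nat.mul_le_mul_right k hb
  · filter_upwards [hconst hx] with k hk n hn
    exact runLen_le_s9 fun j hj => hk j (hj.trans_le hn)
end
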